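/- Let 𝔉 be a Fraïssé class, let 𝔟₁ be the ideal of P generated by the elements L((X,a),(Y,b),i) over all L-data, and let 𝔟₂ be the ideal of P generated by the elements Q(X,a,b) over all Q-data. Then the assignment ⟦X,a⟧ ↦ [X,a] induces a ring isomorphism P/(𝔟₁+𝔟₂) → Θ(𝔉). -/

import Mathlib

/-! # Relational structures, embeddings, amalgamations, Fraïssé classes -/

namespace Paper

/-- A relational signature: a set `I` of relation symbols with arities `≥ 1`. -/
structure Signature : Type 1 where
  I : Type
  arity : I → ℕ
  arity_pos : ∀ i, 1 ≤ arity i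

variable {σ : Signature}

/-- A (finite relational) structure for the signature `σ`. -/
structure Struc (σ : Signature) : Type 1 where
  carrier : Type
  [fin : Finite carrier]
  rel : ∀ i : σ.I, (Fin (σ.arity i) → carrier) → Prop

attribute [instance] Struc.fin

/-- An embedding of structures: an injection under which the relations on the source are
exactly the restrictions of the relations on the target. -/
structure Emb (X Y : Struc σ) : Type where
  toFun : X.carrier → Y.carrier
  inj : Function.Injective toFun
  rel_iff : ∀ (i : σ.I) (v : Fin (σ.arity i) → X.carrier),
    Y.rel i (fun j => toFun (v j)) ↔ X.rel i v

/-- The identity embedding. -/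
def Emb.id (X : Struc σ) : Emb X X where
  toFun := fun x => x
  inj := fun _ _ h => h
  rel_iff := fun _ _ => Iff.rfl

/-- Composition of embeddings. -/
def Emb.comp {X Y Z : Struc σ} (g : Emb Y Z) (f : Emb X Y) : Emb X Z where
  toFun := fun x => g.toFun (f.toFun x)
  inj := fun _ _ h => f.inj (g.inj h)
  rel_iff := fun i v => (g.rel_iff i fun j => f.toFun (v j)).trans (f.rel_iff i v)

/-- An embedding is an isomorphism if it is surjective. -/
def Emb.IsIso {X Y : Struc σ} (f : Emb X Y) : Prop := Function.Surjective f.toFun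

/-- Two structures are isomorphic. -/
def StrucIso (X Y : Struc σ) : Prop := ∃ f : Emb X Y, f.IsIso

theorem strucIso_refl (X : Struc σ) : StrucIso X X := ⟨Emb.id X, fun y => ⟨y, rfl⟩⟩

/-- The induced structure on a subset of the carrier. -/
def Struc.restrict (X : Struc σ) (S : Set X.carrier) : Struc σ where
  carrier := S
  rel := fun i v => X.rel i (fun j => (v j : X.carrier))

/-- The inclusion embedding of an induced substructure into the whole structure. -/
def Struc.subEmb (X : Struc σ) (S : Set X.carrier) : Emb (X.restrict S) X where
  toFun := fun a => a.1
  inj := fun _ _ h => Subtype.ext h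
  rel_iff := fun _ _ => Iff.rfl

/-- The inclusion embedding between induced substructures on nested subsets. -/
def Struc.inclEmb (X : Struc σ) {S T : Set X.carrier} (h : S ⊆ T) :
    Emb (X.restrict S) (X.restrict T) where
  toFun := fun a => ⟨a.1, h a.2⟩
  inj := fun a b hab => Subtype.ext (Subtype.mk_eq_mk.mp (by exact hab))
  rel_iff := fun _ _ => Iff.rfl

/-- An amalgamation of `Y₁` and `Y₂` over `X` (along `i₁`, `i₂`). -/
structure Amalg {X Y₁ Y₂ : Struc σ} (i₁ : Emb X Y₁) (i₂ : Emb X Y₂) : Type 1 where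
  Z : Struc σ
  j₁ : Emb Y₁ Z
  j₂ : Emb Y₂ Z
  comm : ∀ x, j₁.toFun (i₁.toFun x) = j₂.toFun (i₂.toFun x)
  surj : ∀ z, z ∈ Set.range j₁.toFun ∪ Set.range j₂.toFun

/-- Isomorphism of amalgamations: a structure isomorphism commuting with the two
embeddings. -/
def Amalg.Iso {X Y₁ Y₂ : Struc σ} {i₁ : Emb X Y₁} {i₂ : Emb X Y₂}
    (A B : Amalg i₁ i₂) : Prop :=
  ∃ f : Emb A.Z B.Z, f.IsIso ∧ (∀ y, f.toFun (A.j₁.toFun y) = B.j₁.toFun y) ∧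
    (∀ y, f.toFun (A.j₂.toFun y) = B.j₂.toFun y)

/-- A structure lies in the class `F` up to isomorphism. -/
def MemUpIso (F : Set (Struc σ)) (X : Struc σ) : Prop := ∃ W ∈ F, StrucIso X W

theorem memUpIso_of_mem {F : Set (Struc σ)} {X : Struc σ} (h : X ∈ F) : MemUpIso F X :=
  ⟨X, h, strucIso_refl X⟩

/-- A Fraïssé class. -/
structure IsFraisse (F : Set (Struc σ)) : Prop where
  nonempty : F.Nonempty
  finClasses : ∀ n : ℕ, ∃ (m : ℕ) (r : Fin m → Struc σ),
    ∀ X ∈ F, Nat.card X.carrier = n → ∃ α, StrucIso X (r α)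
  hereditary : ∀ X ∈ F, ∀ Y : Struc σ, Nonempty (Emb Y X) → MemUpIso F Y
  amalg : ∀ (X Y₁ Y₂ : Struc σ), X ∈ F → Y₁ ∈ F → Y₂ ∈ F →
    ∀ (i₁ : Emb X Y₁) (i₂ : Emb X Y₂), ∃ A : Amalg i₁ i₂, MemUpIso F A.Z

theorem pair_compl_subset_left {α : Type*} (a b : α) : ({a, b} : Set α)ᶜ ⊆ ({a} : Set α)ᶜ :=
  Set.compl_subset_compl.mpr (fun _ hx => Set.mem_insert_iff.mpr (Or.inl hx))

theorem pair_compl_subset_right {α : Type*} (a b : α) : ({a, b} : Set α)ᶜ ⊆ ({b} : Set α)ᶜ :=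
  Set.compl_subset_compl.mpr (fun _ hx => Set.mem_insert_iff.mpr (Or.inr hx))

/-- The canonical amalgamation of `X∖{a}` and `X∖{b}` over `X∖{a,b}`, namely `X` itself. -/
def canonAmalg (X : Struc σ) (a b : X.carrier) (hab : a ≠ b) :
    Amalg (X.inclEmb (pair_compl_subset_left a b)) (X.inclEmb (pair_compl_subset_right a b)) where
  Z := X
  j₁ := X.subEmb ({a} : Set X.carrier)ᶜ
  j₂ := X.subEmb ({b} : Set X.carrier)ᶜ
  comm := fun _ => rfl
  surj := fun z => by
    by_cases hz : z = a
    · exact Or.inr ⟨⟨z, by simp only [Set.mem_compl_iff, Set.mem_singleton_iff, hz]; exact hab⟩, rfl⟩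
    · exact Or.inl ⟨⟨z, by simp [hz]⟩, rfl⟩

/-- Two distinct elements `a b` of `X` are separated (relative to the class `F`) if `X` is,
up to isomorphism of amalgamations, the unique amalgamation of `X∖{a}` and `X∖{b}` over
`X∖{a,b}` lying in `F`. -/
def Separated (F : Set (Struc σ)) (X : Struc σ) (a b : X.carrier) (hab : a ≠ b) : Prop :=
  ∀ A : Amalg (X.inclEmb (pair_compl_subset_left a b)) (X.inclEmb (pair_compl_subset_right a b)),
    MemUpIso F A.Z → A.Iso (canonAmalg X a b hab)

/-- Stably separated: every embedding into a member of `F` sends `a`, `b` to separated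
elements. -/
def StablySeparated (F : Set (Struc σ)) (X : Struc σ) (a b : X.carrier) (hab : a ≠ b) : Prop :=
  ∀ X' : Struc σ, MemUpIso F X' → ∀ f : Emb X X',
    Separated F X' (f.toFun a) (f.toFun b) (fun h => hab (f.inj h))

/-- Isomorphism of marked structures. -/
def MarkedIso (X : Struc σ) (a : X.carrier) (Y : Struc σ) (b : Y.carrier) : Prop :=
  ∃ f : Emb X Y, f.IsIso ∧ f.toFun a = b

/-- `b` is extraneous in the marked structure `(X, a)` if it is separated from `a`. -/
def Extraneous (F : Set (Struc σ)) (X : Struc σ) (a b : X.carrier) : Prop :=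
  ∃ h : a ≠ b, Separated F X a b h

/-- A marked structure is minimal if it has no extraneous elements. -/
def MinimalMarked (F : Set (Struc σ)) (X : Struc σ) (a : X.carrier) : Prop :=
  ∀ b : X.carrier, ¬ Extraneous F X a b

/-- `f : W → X` is a one-point extension missing exactly `a`. -/
def IsOnePointExt {W X : Struc σ} (f : Emb W X) (a : X.carrier) : Prop :=
  Set.range f.toFun = ({a} : Set X.carrier)ᶜ

end Paper

/-! # The ring `Θ(𝔉)` of a Fraïssé class -/

namespace Paper

variable {σ : Signature}

/-- Generators of `Θ(𝔉)`: one for each embedding between members of `𝔉`. -/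
def ThetaGen (F : Set (Struc σ)) : Type 1 :=
  Σ (X : {X : Struc σ // X ∈ F}) (Y : {Y : Struc σ // Y ∈ F}), Emb X.1 Y.1

/-- The polynomial ring on the generators of `Θ(𝔉)`. -/
abbrev ThetaPoly (F : Set (Struc σ)) := MvPolynomial (ThetaGen F) ℤ

/-- The generator `[i]` for an embedding `i : X → Y` between members of `𝔉`. -/
noncomputable def thetaVar {F : Set (Struc σ)} (X Y : Struc σ) (hX : X ∈ F) (hY : Y ∈ F)
    (f : Emb X Y) : ThetaPoly F :=
  MvPolynomial.X ⟨⟨X, hX⟩, ⟨Y, hY⟩, f⟩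

/-- The defining relations of `Θ(𝔉)`: `[i] = 1` for isomorphisms, `[j∘i] = [j]·[i]`,
and the amalgamation relations `[i] = Σ_α [i'_α]` where `i'_α` runs over a complete
irredundant system of representatives of the isomorphism classes of amalgamations
lying in `𝔉`. -/
def ThetaRels (F : Set (Struc σ)) : Set (ThetaPoly F) :=
  {p | ∃ (X Y : Struc σ) (hX : X ∈ F) (hY : Y ∈ F) (f : Emb X Y),
      f.IsIso ∧ p = thetaVar X Y hX hY f - 1} ∪
  {p | ∃ (X Y Z : Struc σ) (hX : X ∈ F) (hY : Y ∈ F) (hZ : Z ∈ F)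
      (f : Emb X Y) (g : Emb Y Z),
      p = thetaVar X Z hX hZ (g.comp f) - thetaVar Y Z hY hZ g * thetaVar X Y hX hY f} ∪
  {p | ∃ (X Y X' : Struc σ) (hX : X ∈ F) (hY : Y ∈ F) (hX' : X' ∈ F)
      (i : Emb X Y) (f : Emb X X') (m : ℕ) (r : Fin m → Amalg i f)
      (hr : ∀ α, (r α).Z ∈ F),
      (∀ A : Amalg i f, MemUpIso F A.Z → ∃ α, A.Iso (r α)) ∧
      (∀ α β, (r α).Iso (r β) → α = β) ∧
      p = thetaVar X Y hX hY i - ∑ α, thetaVar X' (r α).Z hX' (hr α) ((r α).j₂)}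

/-- The ring `Θ(𝔉)`. -/
abbrev ThetaRing (F : Set (Struc σ)) : Type 1 :=
  ThetaPoly F ⧸ Ideal.span (ThetaRels F)

/-- The class `[i] ∈ Θ(𝔉)` of an embedding between members of `𝔉`. -/
noncomputable def thetaClass {F : Set (Struc σ)} (X Y : Struc σ) (hX : X ∈ F) (hY : Y ∈ F)
    (f : Emb X Y) : ThetaRing F :=
  Ideal.Quotient.mk _ (thetaVar X Y hX hY f)

end Paper

/-! # The polynomial ring `P` on marked structures, L-data and Q-data -/

namespace Paper

open scoped Classical

variable {σ : Signature}

theorem memUpIso_restrict {F : Set (Struc σ)} (hF : IsFraisse F) {X : Struc σ}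
    (hX : MemUpIso F X) (S : Set X.carrier) : MemUpIso F (X.restrict S) := by
  obtain ⟨W, hW, f, hf⟩ := hX
  exact hF.hereditary W hW _ ⟨f.comp (X.subEmb S)⟩

/-- Marked structures whose underlying structure lies in `F` (up to isomorphism). -/
def MarkedIn (F : Set (Struc σ)) : Type 1 :=
  Σ X : {X : Struc σ // MemUpIso F X}, X.1.carrier

/-- Isomorphism of marked structures, as a relation on `MarkedIn F`. -/
def markedInRel (F : Set (Struc σ)) (p q : MarkedIn F) : Prop :=
  MarkedIso p.1.1 p.2 q.1.1 q.2

/-- Isomorphism classes of marked structures in `F`. -/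
def MarkedCls (F : Set (Struc σ)) : Type 1 := Quot (markedInRel F)

/-- The polynomial ring `P` over `ℤ` with one variable for each isomorphism class of
marked structures in `F`. -/
abbrev PRing (F : Set (Struc σ)) : Type 1 := MvPolynomial (MarkedCls F) ℤ

/-- The variable `⟦X,a⟧` of `P`. -/
noncomputable def mVar {F : Set (Struc σ)} (X : Struc σ) (hX : MemUpIso F X)
    (a : X.carrier) : PRing F :=
  MvPolynomial.X (Quot.mk _ ⟨⟨X, hX⟩, a⟩)

/-- For an L-datum `((X,a),(Y,b),i)`: the isomorphism `i : X∖{a} → Y∖{b}` extends to an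
isomorphism `X → Y`. -/
def LExtends {X Y : Struc σ} {a : X.carrier} {b : Y.carrier}
    (i : Emb (X.restrict ({a} : Set X.carrier)ᶜ) (Y.restrict ({b} : Set Y.carrier)ᶜ)) :
    Prop :=
  ∃ g : Emb X Y, g.IsIso ∧
    ∀ w : (X.restrict ({a} : Set X.carrier)ᶜ).carrier, g.toFun w.1 = (i.toFun w).1

/-- `p` is the element `L((X,a),(Y,b),i) = ⟦X,a⟧ − δ − Σ_α ⟦X_α,a⟧` of `P` associated to
the L-datum `((X,a),(Y,b),i)`, computed with respect to some complete irredundant system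
of representatives `X_α` of the isomorphism classes of amalgamations of `X` and `Y` over
`X∖{a} ≅ Y∖{b}` lying in `F` in which `a` and `b` remain distinct. -/
def IsLElt (F : Set (Struc σ)) {X Y : Struc σ} (hX : MemUpIso F X) (hY : MemUpIso F Y)
    (a : X.carrier) (b : Y.carrier)
    (i : Emb (X.restrict ({a} : Set X.carrier)ᶜ) (Y.restrict ({b} : Set Y.carrier)ᶜ))
    (p : PRing F) : Prop :=
  ∃ (m : ℕ)
    (r : Fin m → Amalg (X.subEmb ({a} : Set X.carrier)ᶜ)
      ((Y.subEmb ({b} : Set Y.carrier)ᶜ).comp i))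
    (hr : ∀ α, MemUpIso F (r α).Z),
    (∀ α, (r α).j₁.toFun a ≠ (r α).j₂.toFun b) ∧
    (∀ A : Amalg (X.subEmb ({a} : Set X.carrier)ᶜ)
        ((Y.subEmb ({b} : Set Y.carrier)ᶜ).comp i),
      MemUpIso F A.Z → A.j₁.toFun a ≠ A.j₂.toFun b → ∃ α, A.Iso (r α)) ∧
    (∀ α β, (r α).Iso (r β) → α = β) ∧
    p = mVar X hX a - (if LExtends i then 1 else 0) -
      ∑ α, mVar (r α).Z (hr α) ((r α).j₁.toFun a)

/-- The element `Q(X,a,b) = ⟦X,a⟧·⟦X∖{a},b⟧ − ⟦X,b⟧·⟦X∖{b},a⟧` of `P` associated to a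
Q-datum `(X,a,b)`. -/
noncomputable def qElt {F : Set (Struc σ)} (X : Struc σ) (hX : MemUpIso F X)
    (a b : X.carrier) (hab : a ≠ b)
    (ha : MemUpIso F (X.restrict ({a} : Set X.carrier)ᶜ))
    (hb : MemUpIso F (X.restrict ({b} : Set X.carrier)ᶜ)) : PRing F :=
  mVar X hX a * mVar _ ha ⟨b, Set.mem_compl_singleton_iff.mpr (Ne.symm hab)⟩ -
    mVar X hX b * mVar _ hb ⟨a, Set.mem_compl_singleton_iff.mpr hab⟩

/-- The generators of the ideal `𝔟₀`: the differences `⟦X,a⟧ − ⟦X∖{b},a⟧` over all marked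
structures `(X,a)` with an extraneous element `b`. -/
def B0Set (F : Set (Struc σ)) : Set (PRing F) :=
  {p | ∃ (X : Struc σ) (hX : MemUpIso F X) (a b : X.carrier) (h : a ≠ b),
    Separated F X a b h ∧
    ∃ h' : MemUpIso F (X.restrict ({b} : Set X.carrier)ᶜ),
      p = mVar X hX a -
        mVar (X.restrict ({b} : Set X.carrier)ᶜ) h'
          ⟨a, Set.mem_compl_singleton_iff.mpr h⟩}

/-- The generators of the ideal `𝔟₁`: the elements `L(D)` over all L-data `D`. -/
def LSet (F : Set (Struc σ)) : Set (PRing F) :=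
  {p | ∃ (X Y : Struc σ) (hX : MemUpIso F X) (hY : MemUpIso F Y)
    (a : X.carrier) (b : Y.carrier)
    (i : Emb (X.restrict ({a} : Set X.carrier)ᶜ) (Y.restrict ({b} : Set Y.carrier)ᶜ)),
    i.IsIso ∧ IsLElt F hX hY a b i p}

/-- The generators of the ideal `𝔟₂`: the elements `Q(D)` over all Q-data `D`. -/
def QSet (F : Set (Struc σ)) : Set (PRing F) :=
  {p | ∃ (X : Struc σ) (hX : MemUpIso F X) (a b : X.carrier) (hab : a ≠ b)
    (ha : MemUpIso F (X.restrict ({a} : Set X.carrier)ᶜ))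
    (hb : MemUpIso F (X.restrict ({b} : Set X.carrier)ᶜ)),
    X ∈ F ∧ p = qElt X hX a b hab ha hb}

end Paper

namespace Paper

open scoped Classical

variable {σ : Signature} {F : Set (Struc σ)}

/-! ### Embeddings and isomorphisms -/

theorem Emb.ext_toFun {X Y : Struc σ} {f g : Emb X Y} (h : ∀ x, f.toFun x = g.toFun x) :
    f = g := by
  cases f; cases g
  congr
  exact funext h

theorem Emb.id_isIso (X : Struc σ) : (Emb.id X).IsIso := fun y => ⟨y, rfl⟩

theorem Emb.IsIso.comp {X Y Z : Struc σ} {g : Emb Y Z} {f : Emb X Y} (hg : g.IsIso)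
    (hf : f.IsIso) : (g.comp f).IsIso :=
  Function.Surjective.comp (f := f.toFun) hg hf

/-- An embedding factors through any embedding whose range contains its own. -/
theorem Emb.exists_lift {A B C : Struc σ} (u : Emb A C) (v : Emb B C)
    (h : ∀ a, ∃ b, v.toFun b = u.toFun a) :
    ∃ w : Emb A B, ∀ a, v.toFun (w.toFun a) = u.toFun a := by
  choose w hw using h
  refine ⟨⟨w, fun a a' haa => u.inj ?_, fun i t => ?_⟩, hw⟩
  · rw [← hw a, ← hw a', haa]
  · rw [← v.rel_iff, ← u.rel_iff]
    simp only [hw]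

theorem Emb.IsIso.exists_inv {X Y : Struc σ} {f : Emb X Y} (hf : f.IsIso) :
    ∃ g : Emb Y X, g.IsIso ∧ (∀ x, g.toFun (f.toFun x) = x) ∧
      ∀ y, f.toFun (g.toFun y) = y := by
  obtain ⟨g, hg⟩ := Emb.exists_lift (Emb.id Y) f hf
  have hgf : ∀ x, g.toFun (f.toFun x) = x := fun x => f.inj (hg _)
  exact ⟨g, fun x => ⟨_, hgf x⟩, hgf, hg⟩

theorem MemUpIso.of_iso {X Y : Struc σ} {f : Emb X Y} (hf : f.IsIso) (hY : MemUpIso F Y) :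
    MemUpIso F X := by
  obtain ⟨W, hW, g, hg⟩ := hY
  exact ⟨W, hW, g.comp f, hg.comp hf⟩

theorem MemUpIso.of_emb (hF : IsFraisse F) {X Y : Struc σ} (f : Emb X Y)
    (hY : MemUpIso F Y) : MemUpIso F X := by
  obtain ⟨W, hW, g, -⟩ := hY
  exact hF.hereditary W hW X ⟨g.comp f⟩

/-! ### The number of points missed by an embedding -/

/-- The number of points of the target missed by an embedding. -/
noncomputable def Emb.codim {X Y : Struc σ} (f : Emb X Y) : ℕ := (Set.range f.toFun)ᶜ.ncard

theorem Emb.codim_eq_zero {X Y : Struc σ} {f : Emb X Y} : f.codim = 0 ↔ f.IsIso := by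
  rw [Emb.codim, Set.ncard_eq_zero, Set.compl_empty_iff, Set.range_eq_univ]
  rfl

theorem Struc.range_subEmb (X : Struc σ) (S : Set X.carrier) :
    Set.range (X.subEmb S).toFun = S :=
  Subtype.range_coe

theorem Struc.codim_subEmb (X : Struc σ) (a : X.carrier) :
    (X.subEmb ({a} : Set X.carrier)ᶜ).codim = 1 := by
  rw [Emb.codim, X.range_subEmb, compl_compl, Set.ncard_singleton]

/-- An embedding missing a point `b` factors through the complement of `b`. -/
theorem Emb.exists_factor {X Y : Struc σ} (f : Emb X Y) (b : Y.carrier)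
    (hb : b ∉ Set.range f.toFun) :
    ∃ k : Emb X (Y.restrict ({b} : Set Y.carrier)ᶜ),
      f = (Y.subEmb ({b} : Set Y.carrier)ᶜ).comp k := by
  obtain ⟨k, hk⟩ := Emb.exists_lift f (Y.subEmb ({b} : Set Y.carrier)ᶜ)
    fun x => ⟨⟨f.toFun x, fun h => hb ⟨x, h⟩⟩, rfl⟩
  exact ⟨k, Emb.ext_toFun fun x => (hk x).symm⟩

theorem Emb.codim_subEmb_comp {X Y : Struc σ} {b : Y.carrier}
    (k : Emb X (Y.restrict ({b} : Set Y.carrier)ᶜ)) :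
    ((Y.subEmb ({b} : Set Y.carrier)ᶜ).comp k).codim = k.codim + 1 := by
  have h : (Set.range ((Y.subEmb ({b} : Set Y.carrier)ᶜ).comp k).toFun)ᶜ =
      insert b ((Y.subEmb ({b} : Set Y.carrier)ᶜ).toFun '' (Set.range k.toFun)ᶜ) := by
    ext y
    constructor
    · intro hy
      by_cases hyb : y = b
      · exact Or.inl hyb
      · exact Or.inr ⟨⟨y, hyb⟩, fun ⟨x, hx⟩ => hy ⟨x, congrArg Subtype.val hx⟩, rfl⟩
    · rintro (rfl | ⟨z, hz, rfl⟩) ⟨x, hx⟩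
      · exact (k.toFun x).2 hx
      · exact hz ⟨x, (Y.subEmb _).inj hx⟩
  rw [Emb.codim, h, Set.ncard_insert_of_notMem, Set.ncard_image_of_injective _ (Y.subEmb _).inj,
    Emb.codim]
  rintro ⟨z, -, hz⟩
  exact z.2 hz

theorem Emb.exists_factor_of_codim {X Y : Struc σ} (f : Emb X Y) {n : ℕ}
    (hf : f.codim = n + 1) :
    ∃ (b : Y.carrier) (k : Emb X (Y.restrict ({b} : Set Y.carrier)ᶜ)),
      f = (Y.subEmb ({b} : Set Y.carrier)ᶜ).comp k ∧ k.codim = n := by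
  obtain ⟨b, hb⟩ := Set.nonempty_of_ncard_ne_zero (s := (Set.range f.toFun)ᶜ)
    (by rw [← Emb.codim, hf]; exact Nat.succ_ne_zero n)
  obtain ⟨k, rfl⟩ := f.exists_factor b hb
  refine ⟨b, k, rfl, ?_⟩
  rw [Emb.codim_subEmb_comp] at hf
  exact Nat.succ_injective hf

theorem IsOnePointExt.exists_factor {W X : Struc σ} {g : Emb W X} {a : X.carrier}
    (hg : IsOnePointExt g a) :
    ∃ k : Emb W (X.restrict ({a} : Set X.carrier)ᶜ),
      k.IsIso ∧ g = (X.subEmb ({a} : Set X.carrier)ᶜ).comp k := by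
  obtain ⟨k, rfl⟩ := g.exists_factor a (by rw [show Set.range g.toFun = _ from hg]; simp)
  refine ⟨k, fun y => ?_, rfl⟩
  obtain ⟨w, hw⟩ : y.1 ∈ Set.range ((X.subEmb ({a} : Set X.carrier)ᶜ).comp k).toFun := by
    rw [show Set.range _ = _ from hg]; exact y.2
  exact ⟨w, Subtype.ext hw⟩

/-! ### Amalgamations -/

theorem Amalg.Iso.symm {X Y₁ Y₂ : Struc σ} {i₁ : Emb X Y₁} {i₂ : Emb X Y₂}
    {A B : Amalg i₁ i₂} (h : A.Iso B) : B.Iso A := by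
  obtain ⟨f, hf, h₁, h₂⟩ := h
  obtain ⟨g, hg, hgf, -⟩ := hf.exists_inv
  exact ⟨g, hg, fun y => by rw [← h₁, hgf], fun y => by rw [← h₂, hgf]⟩

theorem Amalg.Iso.refl {X Y₁ Y₂ : Struc σ} {i₁ : Emb X Y₁} {i₂ : Emb X Y₂}
    (A : Amalg i₁ i₂) : A.Iso A :=
  ⟨Emb.id _, Emb.id_isIso _, fun _ => rfl, fun _ => rfl⟩

theorem Amalg.Iso.trans {X Y₁ Y₂ : Struc σ} {i₁ : Emb X Y₁} {i₂ : Emb X Y₂}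
    {A B C : Amalg i₁ i₂} (h : A.Iso B) (h' : B.Iso C) : A.Iso C := by
  obtain ⟨f, hf, h₁, h₂⟩ := h
  obtain ⟨g, hg, hg₁, hg₂⟩ := h'
  exact ⟨g.comp f, hg.comp hf, fun y => (congrArg g.toFun (h₁ y)).trans (hg₁ y),
    fun y => (congrArg g.toFun (h₂ y)).trans (hg₂ y)⟩

/-- Exchange the two sides of an amalgamation. -/
def Amalg.swap {X Y₁ Y₂ : Struc σ} {i₁ : Emb X Y₁} {i₂ : Emb X Y₂} (A : Amalg i₁ i₂) :
    Amalg i₂ i₁ where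
  Z := A.Z
  j₁ := A.j₂
  j₂ := A.j₁
  comm := fun x => (A.comm x).symm
  surj := fun z => (A.surj z).symm

theorem Amalg.Iso.swap {X Y₁ Y₂ : Struc σ} {i₁ : Emb X Y₁} {i₂ : Emb X Y₂}
    {A B : Amalg i₁ i₂} (h : A.Iso B) : A.swap.Iso B.swap := by
  obtain ⟨f, hf, h₁, h₂⟩ := h
  exact ⟨f, hf, h₂, h₁⟩

/-- Paste an amalgamation over `X` with an amalgamation over `Y₁`. -/
def Amalg.paste {X Y₁ Y X' : Struc σ} {i : Emb X Y₁} {f : Emb X X'} {i' : Emb Y₁ Y}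
    (A : Amalg i f) (B : Amalg i' A.j₁) : Amalg (i'.comp i) f where
  Z := B.Z
  j₁ := B.j₁
  j₂ := B.j₂.comp A.j₂
  comm := fun x => (B.comm (i.toFun x)).trans (congrArg B.j₂.toFun (A.comm x))
  surj := fun z => by
    rcases B.surj z with h | ⟨w, rfl⟩
    · exact Or.inl h
    · rcases A.surj w with ⟨y, rfl⟩ | ⟨x, rfl⟩
      · exact Or.inl ⟨i'.toFun y, B.comm y⟩
      · exact Or.inr ⟨x, rfl⟩

theorem Amalg.codim_j₂_le {X Y₁ Y₂ : Struc σ} {i₁ : Emb X Y₁} {i₂ : Emb X Y₂}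
    (A : Amalg i₁ i₂) : A.j₂.codim ≤ i₁.codim := by
  rw [Emb.codim, Emb.codim, ← Set.ncard_image_of_injective _ A.j₁.inj]
  refine Set.ncard_le_ncard fun z hz => ?_
  rcases A.surj z with ⟨y, rfl⟩ | h
  · refine ⟨y, ?_, rfl⟩
    rintro ⟨x, rfl⟩
    exact hz ⟨i₂.toFun x, (A.comm x).symm⟩
  · exact absurd h hz

theorem Amalg.codim_j₁_le {X Y₁ Y₂ : Struc σ} {i₁ : Emb X Y₁} {i₂ : Emb X Y₂}
    (A : Amalg i₁ i₂) : A.j₁.codim ≤ i₂.codim :=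
  A.swap.codim_j₂_le

/-- A complete irredundant system of representatives of the isomorphism classes of
amalgamations lying in `F`. -/
structure IsSys (F : Set (Struc σ)) {X Y₁ Y₂ : Struc σ} {i₁ : Emb X Y₁} {i₂ : Emb X Y₂}
    {ι : Type} (r : ι → Amalg i₁ i₂) : Prop where
  mem : ∀ α, MemUpIso F (r α).Z
  complete : ∀ A : Amalg i₁ i₂, MemUpIso F A.Z → ∃ α, A.Iso (r α)
  irred : ∀ α β, (r α).Iso (r β) → α = β

theorem IsSys.swap {X Y₁ Y₂ : Struc σ} {i₁ : Emb X Y₁} {i₂ : Emb X Y₂} {ι : Type}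
    {r : ι → Amalg i₁ i₂} (hr : IsSys F r) : IsSys F fun α => (r α).swap where
  mem := hr.mem
  complete := fun A hA => (hr.complete A.swap hA).imp fun _ h => h.swap
  irred := fun α β h => hr.irred α β h.swap

theorem IsSys.paste (hF : IsFraisse F) {X Y₁ Y X' : Struc σ} {i : Emb X Y₁} {f : Emb X X'}
    {i' : Emb Y₁ Y} {ι : Type} {r : ι → Amalg i f} (hr : IsSys F r) {κ : ι → Type}
    {s : ∀ α, κ α → Amalg i' (r α).j₁} (hs : ∀ α, IsSys F (s α)) :
    IsSys F fun p : Σ α, κ α => (r p.1).paste (s p.1 p.2) where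
  mem := fun p => (hs p.1).mem p.2
  complete := fun A hA => by
    let S : Set A.Z.carrier := Set.range (A.j₁.comp i').toFun ∪ Set.range A.j₂.toFun
    obtain ⟨k₁, hk₁⟩ := Emb.exists_lift (A.j₁.comp i') (A.Z.subEmb S)
      fun y => ⟨⟨_, Or.inl ⟨y, rfl⟩⟩, rfl⟩
    obtain ⟨k₂, hk₂⟩ := Emb.exists_lift A.j₂ (A.Z.subEmb S)
      fun y => ⟨⟨_, Or.inr ⟨y, rfl⟩⟩, rfl⟩
    let B : Amalg i f :=
      { Z := A.Z.restrict S
        j₁ := k₁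
        j₂ := k₂
        comm := fun x => (A.Z.subEmb S).inj (by rw [hk₁, hk₂]; exact A.comm x)
        surj := by
          rintro ⟨z, ⟨y, rfl⟩ | ⟨x, rfl⟩⟩
          · exact Or.inl ⟨y, (A.Z.subEmb S).inj (hk₁ y)⟩
          · exact Or.inr ⟨x, (A.Z.subEmb S).inj (hk₂ x)⟩ }
    obtain ⟨α, h, hh, h₁, h₂⟩ := hr.complete B (memUpIso_restrict hF hA S)
    obtain ⟨g, hg, hgh, hhg⟩ := hh.exists_inv
    have hg₁ : ∀ y, (A.Z.subEmb S).toFun (g.toFun ((r α).j₁.toFun y)) =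
        A.j₁.toFun (i'.toFun y) := fun y => by
      rw [← h₁, hgh]; exact hk₁ y
    have hg₂ : ∀ y, (A.Z.subEmb S).toFun (g.toFun ((r α).j₂.toFun y)) = A.j₂.toFun y :=
      fun y => by rw [← h₂, hgh]; exact hk₂ y
    let C : Amalg i' (r α).j₁ :=
      { Z := A.Z
        j₁ := A.j₁
        j₂ := (A.Z.subEmb S).comp g
        comm := fun x => (hg₁ x).symm
        surj := fun z => by
          rcases A.surj z with h | ⟨x, rfl⟩
          · exact Or.inl h
          · exact Or.inr ⟨(r α).j₂.toFun x, hg₂ x⟩ }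
    obtain ⟨β, k, hk, hk₁', hk₂'⟩ := (hs α).complete C hA
    refine ⟨⟨α, β⟩, k, hk, hk₁', fun x => ?_⟩
    rw [← hg₂]
    exact hk₂' _
  irred := by
    rintro ⟨α, β⟩ ⟨α', β'⟩ ⟨k, hk, h₁, h₂⟩
    have key : ∀ {α α' β β'} (k : Emb (s α β).Z (s α' β').Z),
        (∀ y, k.toFun ((s α β).j₁.toFun y) = (s α' β').j₁.toFun y) →
        (∀ y, k.toFun ((s α β).j₂.toFun ((r α).j₂.toFun y)) =
          (s α' β').j₂.toFun ((r α').j₂.toFun y)) →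
        ∀ y, k.toFun ((s α β).j₂.toFun ((r α).j₁.toFun y)) =
          (s α' β').j₂.toFun ((r α').j₁.toFun y) := by
      intro α α' β β' k h₁ h₂ y
      rw [← (s α β).comm, h₁, (s α' β').comm]
    have h₃ := key k h₁ h₂
    obtain ⟨w, hw⟩ := Emb.exists_lift (k.comp (s α β).j₂) (s α' β').j₂ fun z => by
      rcases (r α).surj z with ⟨y, rfl⟩ | ⟨y, rfl⟩
      · exact ⟨_, (h₃ y).symm⟩
      · exact ⟨_, (h₂ y).symm⟩
    have hw₁ : ∀ y, w.toFun ((r α).j₁.toFun y) = (r α').j₁.toFun y := fun y =>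
      (s α' β').j₂.inj ((hw _).trans (h₃ y))
    have hw₂ : ∀ y, w.toFun ((r α).j₂.toFun y) = (r α').j₂.toFun y := fun y =>
      (s α' β').j₂.inj ((hw _).trans (h₂ y))
    obtain rfl : α = α' := hr.irred _ _ ⟨w, fun z => by
      rcases (r α').surj z with ⟨y, rfl⟩ | ⟨y, rfl⟩
      · exact ⟨_, hw₁ y⟩
      · exact ⟨_, hw₂ y⟩, hw₁, hw₂⟩
    obtain rfl : β = β' := (hs α).irred _ _ ⟨k, hk, h₁, fun z => by
      rcases (r α).surj z with ⟨y, rfl⟩ | ⟨y, rfl⟩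
      · exact h₃ y
      · exact h₂ y⟩
    rfl

/-- When `i` is an isomorphism there is exactly one amalgamation along `i` and `f`. -/
theorem exists_isSys_of_isIso {X Y X' : Struc σ} {i : Emb X Y} (hi : i.IsIso)
    (f : Emb X X') (hX' : MemUpIso F X') :
    ∃ A : Amalg i f, A.j₂.IsIso ∧ IsSys F fun _ : Unit => A := by
  obtain ⟨g, hg, hgi, hig⟩ := hi.exists_inv
  refine ⟨⟨X', f.comp g, Emb.id X', fun x => congrArg f.toFun (hgi x),
    fun z => Or.inr ⟨z, rfl⟩⟩, Emb.id_isIso _,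
    fun _ => hX', fun A _ => ⟨(), Amalg.Iso.symm ⟨A.j₂, fun z => ?_, fun y => ?_, fun _ => rfl⟩⟩,
    fun _ _ _ => rfl⟩
  · rcases A.surj z with ⟨y, rfl⟩ | h
    · obtain ⟨x, rfl⟩ := hi y
      exact ⟨_, (A.comm x).symm⟩
    · exact h
  · obtain ⟨x, rfl⟩ := hi y
    rw [A.comm x]
    exact congrArg A.j₂.toFun (congrArg f.toFun (hgi x))

theorem Amalg.card_le {X Y₁ Y₂ : Struc σ} {i₁ : Emb X Y₁} {i₂ : Emb X Y₂}
    (A : Amalg i₁ i₂) :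
    Nat.card A.Z.carrier ≤ Nat.card Y₁.carrier + Nat.card Y₂.carrier := by
  rw [← Nat.card_sum]
  refine Nat.card_le_card_of_surjective (Sum.elim A.j₁.toFun A.j₂.toFun) fun z => ?_
  rcases A.surj z with ⟨y, rfl⟩ | ⟨y, rfl⟩
  · exact ⟨Sum.inl y, rfl⟩
  · exact ⟨Sum.inr y, rfl⟩

theorem exists_isSys (hF : IsFraisse F) {X Y₁ Y₂ : Struc σ} (i₁ : Emb X Y₁)
    (i₂ : Emb X Y₂) : ∃ (m : ℕ) (r : Fin m → Amalg i₁ i₂), IsSys F r := by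
  choose m R hR using hF.finClasses
  let Code := Σ (n : Fin (Nat.card Y₁.carrier + Nat.card Y₂.carrier + 1)) (α : Fin (m n)),
    (Y₁.carrier → (R n α).carrier) × (Y₂.carrier → (R n α).carrier)
  let S := {A : Amalg i₁ i₂ // MemUpIso F A.Z}
  let Codes : S → Code → Prop := fun A c =>
    ∃ f : Emb A.1.Z (R c.1 c.2.1), f.IsIso ∧ (∀ y, f.toFun (A.1.j₁.toFun y) = c.2.2.1 y) ∧
      ∀ y, f.toFun (A.1.j₂.toFun y) = c.2.2.2 y
  have hex : ∀ A : S, ∃ c, Codes A c := by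
    rintro ⟨A, W, hW, f, hf⟩
    have hcard : Nat.card W.carrier = Nat.card A.Z.carrier :=
      (Nat.card_congr (Equiv.ofBijective f.toFun ⟨f.inj, hf⟩)).symm
    obtain ⟨α, g, hg⟩ := hR _ W hW hcard
    exact ⟨⟨⟨Nat.card A.Z.carrier, Nat.lt_succ_of_le A.card_le⟩, α,
      fun y => g.toFun (f.toFun (A.j₁.toFun y)), fun y => g.toFun (f.toFun (A.j₂.toFun y))⟩,
      g.comp f, hg.comp hf, fun _ => rfl, fun _ => rfl⟩
  have hiso : ∀ {A B : S} {c}, Codes A c → Codes B c → A.1.Iso B.1 := by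
    rintro A B c ⟨f, hf, h₁, h₂⟩ ⟨g, hg, h₁', h₂'⟩
    obtain ⟨k, hk, hkg, -⟩ := hg.exists_inv
    exact ⟨k.comp f, hk.comp hf,
      fun y => (congrArg k.toFun ((h₁ y).trans (h₁' y).symm)).trans (hkg _),
      fun y => (congrArg k.toFun ((h₂ y).trans (h₂' y).symm)).trans (hkg _)⟩
  let stp : Setoid S := ⟨fun A B => A.1.Iso B.1,
    ⟨fun A => Amalg.Iso.refl A.1, fun h => h.symm, fun h h' => h.trans h'⟩⟩
  have hfin : Finite (Quotient stp) := by
    choose c hc using fun q : Quotient stp => hex q.out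
    refine Finite.of_injective c fun p q hpq => ?_
    rw [← p.out_eq, ← q.out_eq]
    exact Quotient.sound (hiso (hc p) (hpq ▸ hc q))
  obtain ⟨n, ⟨e⟩⟩ := Finite.exists_equiv_fin (Quotient stp)
  refine ⟨n, fun k => (e.symm k).out.1, fun k => (e.symm k).out.2, fun A hA => ?_,
    fun k l h => ?_⟩
  · refine ⟨e ⟦⟨A, hA⟩⟧, Amalg.Iso.symm ?_⟩
    rw [Equiv.symm_apply_apply]
    exact Quotient.mk_out (s := stp) ⟨A, hA⟩
  · apply e.symm.injective
    rw [← (e.symm k).out_eq, ← (e.symm l).out_eq]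
    exact Quotient.sound h

/-! ### Multiplicative invariants of embeddings and the amalgamation relation -/

/-- A ring-valued function on embeddings that is `1` on isomorphisms and multiplicative
under composition (of embeddings between structures lying in `F` up to isomorphism). -/
structure IsMult (F : Set (Struc σ)) {R : Type*} [CommRing R]
    (v : ∀ ⦃X Y : Struc σ⦄, Emb X Y → R) : Prop where
  iso : ∀ {X Y : Struc σ} (f : Emb X Y), MemUpIso F Y → f.IsIso → v f = 1
  comp : ∀ {X Y Z : Struc σ} (g : Emb Y Z) (f : Emb X Y), MemUpIso F Z →
    v (g.comp f) = v g * v f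

/-- The amalgamation relation for `i` and `f`. -/
def SatAmalg (F : Set (Struc σ)) {R : Type*} [CommRing R]
    (v : ∀ ⦃X Y : Struc σ⦄, Emb X Y → R) {X Y X' : Struc σ} (i : Emb X Y) (f : Emb X X') :
    Prop :=
  ∀ (ι : Type) [Fintype ι] (r : ι → Amalg i f), IsSys F r → v i = ∑ α, v (r α).j₂

section Mult

variable {R : Type*} [CommRing R] {v : ∀ ⦃X Y : Struc σ⦄, Emb X Y → R}

theorem IsMult.j₂_eq (hv : IsMult F v) {X Y X' : Struc σ} {i : Emb X Y} {f : Emb X X'}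
    {A B : Amalg i f} (hB : MemUpIso F B.Z) (h : A.Iso B) : v A.j₂ = v B.j₂ := by
  obtain ⟨k, hk, -, h₂⟩ := h
  have : B.j₂ = k.comp A.j₂ := Emb.ext_toFun fun y => (h₂ y).symm
  rw [this, hv.comp _ _ hB, hv.iso k hB hk, one_mul]

theorem IsMult.sum_eq (hv : IsMult F v) {X Y X' : Struc σ} {i : Emb X Y} {f : Emb X X'}
    {ι κ : Type} [Fintype ι] [Fintype κ] {r : ι → Amalg i f} {s : κ → Amalg i f}
    (hs : ∀ β, MemUpIso F (s β).Z)
    (hr_irred : ∀ α α', (r α).Iso (r α') → α = α')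
    (hs_irred : ∀ β β', (s β).Iso (s β') → β = β')
    (hrs : ∀ α, ∃ β, (r α).Iso (s β)) (hsr : ∀ β, ∃ α, (s β).Iso (r α)) :
    ∑ α, v (r α).j₂ = ∑ β, v (s β).j₂ := by
  choose φ hφ using hrs
  refine Fintype.sum_bijective φ ⟨fun α α' h => ?_, fun β => ?_⟩ _ _
    fun α => hv.j₂_eq (hs _) (hφ α)
  · exact hr_irred _ _ ((hφ α).trans (h ▸ (hφ α').symm))
  · obtain ⟨α, hα⟩ := hsr β
    exact ⟨α, hs_irred _ _ ((hφ α).symm.trans hα.symm)⟩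

theorem SatAmalg.of_isSys (hv : IsMult F v) {X Y X' : Struc σ} {i : Emb X Y} {f : Emb X X'}
    {ι : Type} [Fintype ι] {r : ι → Amalg i f} (hr : IsSys F r)
    (h : v i = ∑ α, v (r α).j₂) : SatAmalg F v i f := fun _ _ _ hs =>
  h.trans (hv.sum_eq hs.mem hr.irred hs.irred (fun α => hs.complete _ (hr.mem α))
    fun β => hr.complete _ (hs.mem β))

theorem SatAmalg.of_isIso_left (hv : IsMult F v) {X Y X' : Struc σ} {i : Emb X Y}
    (hi : i.IsIso) (f : Emb X X') (hY : MemUpIso F Y) (hX' : MemUpIso F X') :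
    SatAmalg F v i f := by
  obtain ⟨A, hA₂, hA⟩ := exists_isSys_of_isIso (F := F) hi f hX'
  refine SatAmalg.of_isSys hv hA ?_
  rw [hv.iso i hY hi, Fintype.sum_unique, hv.iso _ (hA.mem ()) hA₂]

theorem SatAmalg.of_isIso_right (hv : IsMult F v) {X Y X' : Struc σ} (i : Emb X Y)
    {f : Emb X X'} (hf : f.IsIso) (hY : MemUpIso F Y) (hX' : MemUpIso F X') :
    SatAmalg F v i f := by
  obtain ⟨A, hA₂, hA⟩ := exists_isSys_of_isIso (F := F) hf i hY
  refine SatAmalg.of_isSys hv hA.swap ?_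
  have h : A.j₁.comp f = A.j₂.comp i := Emb.ext_toFun A.comm
  have h' := congrArg (fun g => v g) h
  simp only [hv.comp _ _ (hA.mem ()), hv.iso _ (hA.mem ()) hA₂, hv.iso f hX' hf, mul_one,
    one_mul] at h'
  rw [Fintype.sum_unique]
  exact h'.symm

theorem SatAmalg.comp_left (hF : IsFraisse F) (hv : IsMult F v) {X Y₁ Y X' : Struc σ}
    {i : Emb X Y₁} {i' : Emb Y₁ Y} {f : Emb X X'} (hY : MemUpIso F Y)
    (h : SatAmalg F v i f)
    (h' : ∀ A : Amalg i f, MemUpIso F A.Z → SatAmalg F v i' A.j₁) :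
    SatAmalg F v (i'.comp i) f := by
  obtain ⟨m, r, hr⟩ := exists_isSys hF i f
  choose n s hs using fun α => exists_isSys hF i' (r α).j₁
  refine SatAmalg.of_isSys hv (hr.paste hF hs) ?_
  rw [hv.comp _ _ hY, h _ r hr, Finset.mul_sum, Fintype.sum_sigma]
  refine Finset.sum_congr rfl fun α _ => ?_
  rw [h' (r α) (hr.mem α) _ (s α) (hs α), Finset.sum_mul]
  exact Finset.sum_congr rfl fun β _ => (hv.comp _ _ ((hs α).mem β)).symm

theorem SatAmalg.comp_right (hF : IsFraisse F) (hv : IsMult F v) {X Y X₁ X' : Struc σ}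
    {i : Emb X Y} {f : Emb X X₁} {f' : Emb X₁ X'}
    (h : SatAmalg F v i f)
    (h' : ∀ A : Amalg i f, MemUpIso F A.Z → SatAmalg F v A.j₂ f') :
    SatAmalg F v i (f'.comp f) := by
  obtain ⟨m, r, hr⟩ := exists_isSys hF i f
  choose n s hs using fun α => exists_isSys hF (r α).j₂ f'
  have key := (hr.swap.paste hF (i' := f') (s := fun α β => (s α β).swap)
    fun α => (hs α).swap).swap
  refine SatAmalg.of_isSys hv key ?_
  rw [h _ r hr, Fintype.sum_sigma]
  exact Finset.sum_congr rfl fun α _ => h' (r α) (hr.mem α) _ (s α) (hs α)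

/-- The amalgamation relation follows from its case of two one-point extensions. -/
theorem SatAmalg.of_onePoint (hF : IsFraisse F) (hv : IsMult F v)
    (h : ∀ (X Y : Struc σ) (a : X.carrier) (b : Y.carrier)
      (k : Emb (X.restrict ({a} : Set X.carrier)ᶜ) (Y.restrict ({b} : Set Y.carrier)ᶜ)),
      MemUpIso F X → MemUpIso F Y → k.IsIso →
      SatAmalg F v (X.subEmb ({a} : Set X.carrier)ᶜ)
        ((Y.subEmb ({b} : Set Y.carrier)ᶜ).comp k))
    {X Y Z : Struc σ} (i : Emb X Y) (f : Emb X Z) (hY : MemUpIso F Y)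
    (hZ : MemUpIso F Z) : SatAmalg F v i f := by
  have h₁ : ∀ {X Y X' : Struc σ} (i : Emb X Y) (f : Emb X X'), MemUpIso F Y →
      MemUpIso F X' → i.codim ≤ 1 → f.codim ≤ 1 → SatAmalg F v i f := by
    intro X Y X' i f hY hX' hi hf
    rcases Nat.le_one_iff_eq_zero_or_eq_one.mp hi with hi | hi
    · exact SatAmalg.of_isIso_left hv (Emb.codim_eq_zero.mp hi) f hY hX'
    obtain ⟨a, k, rfl, hk⟩ := i.exists_factor_of_codim hi
    have hYa := MemUpIso.of_emb hF (Y.subEmb ({a} : Set Y.carrier)ᶜ) hY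
    have hk := Emb.codim_eq_zero.mp hk
    refine SatAmalg.comp_left hF hv hY (SatAmalg.of_isIso_left hv hk f hYa hX') fun A hA => ?_
    rcases Nat.le_one_iff_eq_zero_or_eq_one.mp (A.codim_j₁_le.trans hf) with h0 | h1
    · exact SatAmalg.of_isIso_right hv _ (Emb.codim_eq_zero.mp h0) hY hA
    · obtain ⟨b, l, hl, hl'⟩ := A.j₁.exists_factor_of_codim h1
      rw [hl]
      exact h Y A.Z a b l hY hA (Emb.codim_eq_zero.mp hl')
  have h₂ : ∀ (n : ℕ) {X Y X' : Struc σ} (i : Emb X Y) (f : Emb X X'), MemUpIso F Y →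
      MemUpIso F X' → i.codim ≤ 1 → f.codim = n → SatAmalg F v i f := by
    intro n
    induction n with
    | zero => exact fun i f hY hX' hi hf => h₁ i f hY hX' hi (hf.trans_le zero_le_one)
    | succ n ih =>
      intro X Y X' i f hY hX' hi hf
      obtain ⟨b, k, rfl, hk⟩ := f.exists_factor_of_codim hf
      exact SatAmalg.comp_right hF hv (ih i k hY (MemUpIso.of_emb hF (X'.subEmb _) hX') hi hk)
        fun A hA => h₁ _ _ hA hX' (A.codim_j₂_le.trans hi) (X'.codim_subEmb b).le
  have h₃ : ∀ (n : ℕ) {X Y X' : Struc σ} (i : Emb X Y) (f : Emb X X'), MemUpIso F Y →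
      MemUpIso F X' → i.codim = n → SatAmalg F v i f := by
    intro n
    induction n with
    | zero => exact fun i f hY hX' hi =>
        SatAmalg.of_isIso_left hv (Emb.codim_eq_zero.mp hi) f hY hX'
    | succ n ih =>
      intro X Y X' i f hY hX' hi
      obtain ⟨b, k, rfl, hk⟩ := i.exists_factor_of_codim hi
      exact SatAmalg.comp_left hF hv hY
        (ih k f (MemUpIso.of_emb hF (Y.subEmb _) hY) hX' hk)
        fun A hA => h₂ _ _ _ hY hA (Y.codim_subEmb b).le rfl
  exact h₃ _ i f hY hZ rfl

/-- Multiplicative invariants agreeing on one-point extensions are equal. -/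
theorem IsMult.eq_of_onePoint (hF : IsFraisse F) (hv : IsMult F v)
    {w : ∀ ⦃X Y : Struc σ⦄, Emb X Y → R} (hw : IsMult F w)
    (h : ∀ (X : Struc σ) (a : X.carrier), MemUpIso F X →
      v (X.subEmb ({a} : Set X.carrier)ᶜ) = w (X.subEmb ({a} : Set X.carrier)ᶜ))
    {X Y : Struc σ} (f : Emb X Y) (hY : MemUpIso F Y) : v f = w f := by
  induction hn : f.codim generalizing Y with
  | zero => rw [hv.iso f hY (Emb.codim_eq_zero.mp hn), hw.iso f hY (Emb.codim_eq_zero.mp hn)]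
  | succ n ih =>
    obtain ⟨b, k, rfl, hk⟩ := f.exists_factor_of_codim hn
    rw [hv.comp _ _ hY, hw.comp _ _ hY, h Y b hY,
      ih k (MemUpIso.of_emb hF (Y.subEmb _) hY) hk]

theorem IsMult.onePoint (hF : IsFraisse F) (hv : IsMult F v) {W X : Struc σ} {g : Emb W X}
    {a : X.carrier} (hX : MemUpIso F X) (hg : IsOnePointExt g a) :
    v g = v (X.subEmb ({a} : Set X.carrier)ᶜ) := by
  obtain ⟨k, hk, rfl⟩ := hg.exists_factor
  rw [hv.comp _ _ hX, hv.iso k (MemUpIso.of_emb hF (X.subEmb _) hX) hk, mul_one]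

section LData

variable {X Y : Struc σ} {a : X.carrier} {b : Y.carrier}
  {i : Emb (X.restrict ({a} : Set X.carrier)ᶜ) (Y.restrict ({b} : Set Y.carrier)ᶜ)}

theorem Amalg.isOnePointExt_j₂ (hi : i.IsIso)
    (A : Amalg (X.subEmb ({a} : Set X.carrier)ᶜ) ((Y.subEmb ({b} : Set Y.carrier)ᶜ).comp i))
    (hA : A.j₁.toFun a ≠ A.j₂.toFun b) : IsOnePointExt A.j₂ (A.j₁.toFun a) := by
  ext z
  constructor
  · rintro ⟨y, rfl⟩ (h : A.j₂.toFun y = _)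
    by_cases hy : y = b
    · exact hA (hy ▸ h.symm)
    · obtain ⟨x, hx⟩ := hi ⟨y, hy⟩
      have hc := A.comm x
      have : ((Y.subEmb ({b} : Set Y.carrier)ᶜ).comp i).toFun x = y := congrArg Subtype.val hx
      rw [this, h] at hc
      exact x.2 (A.j₁.inj hc)
  · intro hz
    rcases A.surj z with ⟨x, rfl⟩ | h
    · exact ⟨_, (A.comm ⟨x, fun hx => hz (congrArg A.j₁.toFun hx)⟩).symm⟩
    · exact h

theorem Amalg.isIso_j₂_of_eq
    (A : Amalg (X.subEmb ({a} : Set X.carrier)ᶜ) ((Y.subEmb ({b} : Set Y.carrier)ᶜ).comp i))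
    (hA : A.j₁.toFun a = A.j₂.toFun b) : A.j₂.IsIso := by
  intro z
  rcases A.surj z with ⟨x, rfl⟩ | h
  · by_cases hx : x = a
    · exact ⟨b, hx ▸ hA.symm⟩
    · exact ⟨_, (A.comm ⟨x, hx⟩).symm⟩
  · exact h

/-- In an amalgamation identifying the two marked points, the underlying structure is `Y`
and the other leg is an extension of `i`. -/
theorem Amalg.exists_extension (hi : i.IsIso)
    (A : Amalg (X.subEmb ({a} : Set X.carrier)ᶜ) ((Y.subEmb ({b} : Set Y.carrier)ᶜ).comp i))
    (hA : A.j₁.toFun a = A.j₂.toFun b) :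
    ∃ g : Emb X Y, g.IsIso ∧ g.toFun a = b ∧ (∀ w, g.toFun w.1 = (i.toFun w).1) ∧
      ∀ x, A.j₂.toFun (g.toFun x) = A.j₁.toFun x := by
  obtain ⟨k, hk, hkj, hjk⟩ := (A.isIso_j₂_of_eq hA).exists_inv
  have h₁ : k.toFun (A.j₁.toFun a) = b := by rw [hA, hkj]
  have h₂ : ∀ w : (X.restrict ({a} : Set X.carrier)ᶜ).carrier,
      k.toFun (A.j₁.toFun w.1) = (i.toFun w).1 := fun w =>
    (congrArg k.toFun (A.comm w)).trans (hkj _)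
  refine ⟨k.comp A.j₁, fun y => ?_, h₁, h₂, fun x => hjk _⟩
  by_cases hy : y = b
  · exact ⟨a, h₁.trans hy.symm⟩
  · obtain ⟨w, hw⟩ := hi ⟨y, hy⟩
    exact ⟨w.1, (h₂ w).trans (congrArg Subtype.val hw)⟩

theorem LExtends.marked (hi : i.IsIso) {g : Emb X Y}
    (h : ∀ w : (X.restrict ({a} : Set X.carrier)ᶜ).carrier, g.toFun w.1 = (i.toFun w).1) :
    g.toFun a = b := by
  by_contra hne
  obtain ⟨w, hw⟩ := hi ⟨g.toFun a, hne⟩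
  exact w.2 (g.inj ((h w).trans (congrArg Subtype.val hw)))

/-- The amalgamation relation for an L-datum, split according to whether the two marked
points are identified. -/
theorem IsMult.sum_lDatum (hv : IsMult F v) (hi : i.IsIso) (hY : MemUpIso F Y)
    {ι κ : Type} [Fintype ι] [Fintype κ]
    {r : ι → Amalg (X.subEmb ({a} : Set X.carrier)ᶜ)
      ((Y.subEmb ({b} : Set Y.carrier)ᶜ).comp i)} (hr : IsSys F r)
    {s : κ → Amalg (X.subEmb ({a} : Set X.carrier)ᶜ)
      ((Y.subEmb ({b} : Set Y.carrier)ᶜ).comp i)}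
    (hs : ∀ β, MemUpIso F (s β).Z)
    (hs_ne : ∀ β, (s β).j₁.toFun a ≠ (s β).j₂.toFun b)
    (hs_complete : ∀ A : Amalg (X.subEmb ({a} : Set X.carrier)ᶜ)
        ((Y.subEmb ({b} : Set Y.carrier)ᶜ).comp i),
      MemUpIso F A.Z → A.j₁.toFun a ≠ A.j₂.toFun b → ∃ β, A.Iso (s β))
    (hs_irred : ∀ β β', (s β).Iso (s β') → β = β') :
    ∑ α, v (r α).j₂ = (if LExtends i then 1 else 0) + ∑ β, v (s β).j₂ := by
  have hne : ∀ {A B : Amalg (X.subEmb ({a} : Set X.carrier)ᶜ)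
      ((Y.subEmb ({b} : Set Y.carrier)ᶜ).comp i)}, A.Iso B →
      A.j₁.toFun a = A.j₂.toFun b → B.j₁.toFun a = B.j₂.toFun b := by
    rintro A B ⟨k, -, h₁, h₂⟩ h
    rw [← h₁, ← h₂, h]
  rw [← Fintype.sum_subtype_add_sum_subtype
    (fun α => (r α).j₁.toFun a = (r α).j₂.toFun b) fun α => v (r α).j₂]
  congr 1
  · have hone : ∀ α : {α // (r α).j₁.toFun a = (r α).j₂.toFun b}, v (r α).j₂ = 1 := fun α =>
      hv.iso _ (hr.mem _) (Amalg.isIso_j₂_of_eq _ α.2)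
    rw [Finset.sum_congr rfl fun α _ => hone α, Finset.sum_const, Finset.card_univ]
    split_ifs with hL
    · obtain ⟨g, hg, hgi⟩ := hL
      have hga := LExtends.marked hi hgi
      let B : Amalg (X.subEmb ({a} : Set X.carrier)ᶜ)
          ((Y.subEmb ({b} : Set Y.carrier)ᶜ).comp i) :=
        ⟨Y, g, Emb.id Y, hgi, fun z => Or.inr ⟨z, rfl⟩⟩
      obtain ⟨α, hα⟩ := hr.complete B hY
      have hcard : Fintype.card {α // (r α).j₁.toFun a = (r α).j₂.toFun b} = 1 := by
        refine Fintype.card_eq_one_iff.mpr ⟨⟨α, hne hα hga⟩, fun β => Subtype.ext ?_⟩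
        refine hr.irred _ _ (Amalg.Iso.trans (Amalg.Iso.symm ?_) hα)
        obtain ⟨g', hg', hga', hgi', hj⟩ := (r β).exists_extension hi β.2
        refine ⟨(r β).j₂, Amalg.isIso_j₂_of_eq _ β.2, fun x => ?_, fun _ => rfl⟩
        rw [← hj]
        refine congrArg _ ?_
        by_cases hx : x = a
        · rw [hx]; exact hga.trans hga'.symm
        · exact (hgi ⟨x, hx⟩).trans (hgi' ⟨x, hx⟩).symm
      rw [hcard, one_smul]
    · have : IsEmpty {α // (r α).j₁.toFun a = (r α).j₂.toFun b} := ⟨fun α => hL <| by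
        obtain ⟨g, hg, -, hgi, -⟩ := (r α).exists_extension hi α.2
        exact ⟨g, hg, hgi⟩⟩
      rw [Fintype.card_eq_zero, zero_smul]
  · refine hv.sum_eq (r := fun α : {α // ¬ (r α).j₁.toFun a = (r α).j₂.toFun b} => r α.1) hs
      (fun α α' h => Subtype.ext (hr.irred _ _ h)) hs_irred
      (fun α => hs_complete _ (hr.mem _) α.2) fun β => ?_
    obtain ⟨α, hα⟩ := hr.complete _ (hs β)
    exact ⟨⟨α, fun h => hs_ne β (hne hα.symm h)⟩, hα⟩

end LData

end Mult

/-! ### The invariant of embeddings with values in `P/(𝔟₁+𝔟₂)` -/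

/-- The quotient `P/(𝔟₁+𝔟₂)`. -/
abbrev LQRing (F : Set (Struc σ)) : Type 1 :=
  PRing F ⧸ (Ideal.span (LSet F) + Ideal.span (QSet F))

/-- The class in `P/(𝔟₁+𝔟₂)` of the variable of a marked structure. -/
noncomputable def markCls {X : Struc σ} (hX : MemUpIso F X) (a : X.carrier) : LQRing F :=
  Ideal.Quotient.mk _ (mVar X hX a)

theorem mVar_congr {X Y : Struc σ} (hX : MemUpIso F X) (hY : MemUpIso F Y) {a : X.carrier}
    {b : Y.carrier} (h : MarkedIso X a Y b) : mVar X hX a = mVar Y hY b :=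
  congrArg MvPolynomial.X (Quot.sound h)

theorem markCls_congr {X Y : Struc σ} (hX : MemUpIso F X) (hY : MemUpIso F Y) {a : X.carrier}
    {b : Y.carrier} (h : MarkedIso X a Y b) : markCls hX a = markCls hY b := by
  rw [markCls, markCls, mVar_congr hX hY h]

theorem mk_eq_zero_of_mem_LSet {p : PRing F} (hp : p ∈ LSet F) :
    (Ideal.Quotient.mk _ p : LQRing F) = 0 :=
  Ideal.Quotient.eq_zero_iff_mem.mpr (Ideal.mem_sup_left (Ideal.subset_span hp))

theorem mk_eq_zero_of_mem_QSet {p : PRing F} (hp : p ∈ QSet F) :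
    (Ideal.Quotient.mk _ p : LQRing F) = 0 :=
  Ideal.Quotient.eq_zero_iff_mem.mpr (Ideal.mem_sup_right (Ideal.subset_span hp))

/-- The class of the point `a` of the induced substructure on `T`, and `0` if this makes
no sense. -/
noncomputable def subCls (F : Set (Struc σ)) (Y : Struc σ) (T : Set Y.carrier)
    (a : Y.carrier) : LQRing F :=
  if h : MemUpIso F (Y.restrict T) ∧ a ∈ T then markCls h.1 ⟨a, h.2⟩ else 0

theorem subCls_eq {X Y : Struc σ} {T : Set Y.carrier} (hY : MemUpIso F (Y.restrict T))
    (h : Emb X Y) (hX : MemUpIso F X) (hT : Set.range h.toFun = T) (x : X.carrier) :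
    subCls F Y T (h.toFun x) = markCls hX x := by
  subst hT
  have hx : h.toFun x ∈ Set.range h.toFun := ⟨x, rfl⟩
  rw [subCls, dif_pos ⟨hY, hx⟩]
  obtain ⟨k, hk⟩ := Emb.exists_lift h (Y.subEmb (Set.range h.toFun))
    fun x => ⟨⟨h.toFun x, ⟨x, rfl⟩⟩, rfl⟩
  have hk_iso : k.IsIso := by
    rintro ⟨_, x, rfl⟩
    exact ⟨x, Subtype.ext (hk x)⟩
  have hkx : k.toFun x = ⟨h.toFun x, hx⟩ := Subtype.ext (hk x)
  exact (markCls_congr hX hY ⟨k, hk_iso, hkx⟩).symm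

theorem subCls_image (hF : IsFraisse F) {Y Z : Struc σ} (g : Emb Y Z) (hZ : MemUpIso F Z)
    (T : Set Y.carrier) (a : Y.carrier) :
    subCls F Z (g.toFun '' T) (g.toFun a) = subCls F Y T a := by
  have hY := MemUpIso.of_emb hF g hZ
  by_cases ha : a ∈ T
  · rw [subCls, subCls, dif_pos ⟨memUpIso_restrict hF hZ _, Set.mem_image_of_mem _ ha⟩,
      dif_pos ⟨memUpIso_restrict hF hY _, ha⟩]
    obtain ⟨k, hk⟩ := Emb.exists_lift (g.comp (Y.subEmb T)) (Z.subEmb (g.toFun '' T))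
      fun x => ⟨⟨g.toFun x.1, Set.mem_image_of_mem _ x.2⟩, rfl⟩
    have hk_iso : k.IsIso := by
      rintro ⟨_, x, hx, rfl⟩
      exact ⟨⟨x, hx⟩, Subtype.ext (hk ⟨x, hx⟩)⟩
    have hka : k.toFun ⟨a, ha⟩ = ⟨g.toFun a, Set.mem_image_of_mem _ ha⟩ :=
      Subtype.ext (hk ⟨a, ha⟩)
    exact (markCls_congr _ _ ⟨k, hk_iso, hka⟩).symm
  · rw [subCls, subCls, dif_neg fun h => ha ((g.inj.mem_set_image).mp h.2),
      dif_neg fun h => ha h.2]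

theorem subCls_swap (hF : IsFraisse F) {Y : Struc σ} (hY : MemUpIso F Y) {T : Set Y.carrier}
    {a b : Y.carrier} (ha : a ∈ T) (hb : b ∈ T) (hab : a ≠ b) :
    subCls F Y T a * subCls F Y (T \ {a}) b = subCls F Y T b * subCls F Y (T \ {b}) a := by
  obtain ⟨W, hW, f, hf⟩ := memUpIso_restrict hF hY T
  obtain ⟨g, hg, hgf, -⟩ := hf.exists_inv
  let h : Emb W Y := (Y.subEmb T).comp g
  have hT : Set.range h.toFun = T := by
    rw [show h.toFun = (Y.subEmb T).toFun ∘ g.toFun from rfl,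
      Function.Surjective.range_comp hg, Y.range_subEmb]
  obtain ⟨a', rfl⟩ : a ∈ Set.range h.toFun := hT ▸ ha
  obtain ⟨b', rfl⟩ : b ∈ Set.range h.toFun := hT ▸ hb
  have hab' : a' ≠ b' := fun e => hab (congrArg h.toFun e)
  have hWm := memUpIso_of_mem hW
  have hWa := memUpIso_restrict hF hWm ({a'} : Set W.carrier)ᶜ
  have hWb := memUpIso_restrict hF hWm ({b'} : Set W.carrier)ᶜ
  have hr : ∀ c : W.carrier,
      Set.range (h.comp (W.subEmb ({c} : Set W.carrier)ᶜ)).toFun = T \ {h.toFun c} := by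
    intro c
    rw [show (h.comp (W.subEmb ({c} : Set W.carrier)ᶜ)).toFun =
      h.toFun ∘ (W.subEmb ({c} : Set W.carrier)ᶜ).toFun from rfl, Set.range_comp,
      W.range_subEmb, Set.image_compl_eq_range_sdiff_image h.inj, hT, Set.image_singleton]
  rw [subCls_eq (memUpIso_restrict hF hY _) h hWm hT,
    subCls_eq (memUpIso_restrict hF hY _) h hWm hT]
  have e₁ := subCls_eq (memUpIso_restrict hF hY _)
    (h.comp (W.subEmb ({a'} : Set W.carrier)ᶜ)) hWa (hr a')
    ⟨b', Set.mem_compl_singleton_iff.mpr hab'.symm⟩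
  have e₂ := subCls_eq (memUpIso_restrict hF hY _)
    (h.comp (W.subEmb ({b'} : Set W.carrier)ᶜ)) hWb (hr b')
    ⟨a', Set.mem_compl_singleton_iff.mpr hab'⟩
  refine (congrArg _ e₁).trans (Eq.trans ?_ (congrArg _ e₂).symm)
  rw [← sub_eq_zero]
  exact mk_eq_zero_of_mem_QSet ⟨W, hWm, a', b', hab', hWa, hWb, hW, rfl⟩

/-- The product of the classes of the points of a list, removed from `T` one by one. -/
noncomputable def listCls (F : Set (Struc σ)) (Y : Struc σ) :
    Set Y.carrier → List Y.carrier → LQRing F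
  | _, [] => 1
  | T, a :: l => subCls F Y T a * listCls F Y (T \ {a}) l

theorem listCls_perm (hF : IsFraisse F) {Y : Struc σ} (hY : MemUpIso F Y)
    {l l' : List Y.carrier} (h : l.Perm l') {T : Set Y.carrier} (hl : l.Nodup)
    (hT : ∀ x ∈ l, x ∈ T) : listCls F Y T l = listCls F Y T l' := by
  induction h generalizing T with
  | nil => rfl
  | cons a _ ih =>
    rw [List.nodup_cons] at hl
    have ha : ∀ x ∈ _, x ∈ T \ {a} := fun x hx =>
      ⟨hT x (List.mem_cons_of_mem _ hx), fun e => hl.1 (e ▸ hx)⟩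
    rw [listCls, listCls, ih hl.2 ha]
  | swap a b l =>
    have hab : b ≠ a := fun e => by simp [e] at hl
    simp only [listCls]
    rw [← mul_assoc, ← mul_assoc, subCls_swap hF hY (hT b (by simp)) (hT a (by simp)) hab,
      Set.sdiff_sdiff_comm]
  | trans h₁ _ ih₁ ih₂ =>
    rw [ih₁ hl hT, ih₂ (h₁.nodup_iff.mp hl) fun x hx => hT x (h₁.mem_iff.mpr hx)]

theorem listCls_append {Y : Struc σ} (T : Set Y.carrier) (l l' : List Y.carrier) :
    listCls F Y T (l ++ l') = listCls F Y T l * listCls F Y (T \ {x | x ∈ l}) l' := by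
  induction l generalizing T with
  | nil => simp [listCls]
  | cons a l ih =>
    rw [List.cons_append, listCls, listCls, ih, mul_assoc, Set.sdiff_sdiff]
    congr 4
    ext x
    simp

theorem listCls_map (hF : IsFraisse F) {Y Z : Struc σ} (g : Emb Y Z) (hZ : MemUpIso F Z)
    (T : Set Y.carrier) (l : List Y.carrier) :
    listCls F Z (g.toFun '' T) (l.map g.toFun) = listCls F Y T l := by
  induction l generalizing T with
  | nil => rfl
  | cons a l ih =>
    rw [List.map_cons, listCls, listCls, subCls_image hF g hZ, ← Set.image_singleton,
      ← Set.image_sdiff g.inj, ih]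

/-- The class of an embedding in `P/(𝔟₁+𝔟₂)`, computed by removing the missed points one
by one. -/
noncomputable def embCls (F : Set (Struc σ)) ⦃X Y : Struc σ⦄ (f : Emb X Y) : LQRing F :=
  listCls F Y Set.univ (Set.range f.toFun)ᶜ.toFinite.toFinset.toList

theorem embCls_eq (hF : IsFraisse F) {X Y : Struc σ} (f : Emb X Y) (hY : MemUpIso F Y)
    {l : List Y.carrier} (hl : l.Nodup) (h : ∀ y, y ∈ l ↔ y ∉ Set.range f.toFun) :
    embCls F f = listCls F Y Set.univ l :=
  listCls_perm hF hY ((List.perm_ext_iff_of_nodup (Finset.nodup_toList _) hl).mpr fun y => by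
    simp [h]) (Finset.nodup_toList _) fun _ _ => Set.mem_univ _

theorem embCls_subEmb (hF : IsFraisse F) {X : Struc σ} (hX : MemUpIso F X) (a : X.carrier) :
    embCls F (X.subEmb ({a} : Set X.carrier)ᶜ) = markCls hX a := by
  rw [embCls_eq hF _ hX (l := [a]) (List.nodup_singleton a) (by
    intro y; rw [X.range_subEmb]; simp), listCls, listCls, mul_one]
  exact subCls_eq (memUpIso_restrict hF hX _) (Emb.id X) hX Set.range_id a

theorem isMult_embCls (hF : IsFraisse F) : IsMult F (embCls F) where
  iso := fun {X Y} f hY hf => by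
    rw [embCls_eq hF f hY List.nodup_nil fun y => by simpa using hf y, listCls]
  comp := fun {X Y Z} g f hZ => by
    have hY := MemUpIso.of_emb hF g hZ
    have hlist : ∀ {X Y : Struc σ} (f : Emb X Y),
        ∃ l : List Y.carrier, l.Nodup ∧ ∀ y, y ∈ l ↔ y ∉ Set.range f.toFun := fun f =>
      ⟨(Set.range f.toFun)ᶜ.toFinite.toFinset.toList, Finset.nodup_toList _, by simp⟩
    obtain ⟨l, hl, hlm⟩ := hlist f
    obtain ⟨m, hm, hmm⟩ := hlist g
    have hdiff : Set.univ \ {z | z ∈ m} = g.toFun '' Set.univ := by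
      ext z
      simp [hmm]
    rw [embCls_eq hF g hZ hm hmm, embCls_eq hF f hY hl hlm, ← listCls_map hF g hZ, ← hdiff,
      ← listCls_append]
    refine embCls_eq hF _ hZ (hm.append (hl.map g.inj) ?_) fun z => ?_
    · intro z hz hz'
      obtain ⟨y, -, rfl⟩ := List.mem_map.mp hz'
      exact (hmm _).mp hz ⟨y, rfl⟩
    · rw [List.mem_append, hmm, List.mem_map]
      constructor
      · rintro (h | ⟨y, hy, rfl⟩) ⟨x, hx⟩
        · exact h ⟨f.toFun x, hx⟩
        · exact (hlm y).mp hy ⟨x, g.inj hx⟩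
      · intro h
        by_cases hz : z ∈ Set.range g.toFun
        · obtain ⟨y, rfl⟩ := hz
          refine Or.inr ⟨y, (hlm y).mpr ?_, rfl⟩
          rintro ⟨x, rfl⟩
          exact h ⟨x, rfl⟩
        · exact Or.inl hz

theorem satAmalg_embCls (hF : IsFraisse F) {X Y X' : Struc σ} (i : Emb X Y) (f : Emb X X')
    (hY : MemUpIso F Y) (hX' : MemUpIso F X') : SatAmalg F (embCls F) i f := by
  have hv := isMult_embCls hF
  refine SatAmalg.of_onePoint hF hv (fun X Y a b k hX hY hk => ?_) i f hY hX'
  obtain ⟨m, r, hr⟩ := exists_isSys hF (X.subEmb ({a} : Set X.carrier)ᶜ)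
    ((Y.subEmb ({b} : Set Y.carrier)ᶜ).comp k)
  refine SatAmalg.of_isSys hv hr ?_
  obtain ⟨n, ⟨e⟩⟩ :=
    Finite.exists_equiv_fin {α // (r α).j₁.toFun a ≠ (r α).j₂.toFun b}
  have hmem : ∀ β, MemUpIso F (r (e.symm β).1).Z := fun β => hr.mem _
  have hcomplete : ∀ A : Amalg (X.subEmb ({a} : Set X.carrier)ᶜ)
      ((Y.subEmb ({b} : Set Y.carrier)ᶜ).comp k), MemUpIso F A.Z →
      A.j₁.toFun a ≠ A.j₂.toFun b → ∃ β, A.Iso (r (e.symm β).1) := by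
    intro A hA hne
    obtain ⟨α, hα⟩ := hr.complete A hA
    refine ⟨e ⟨α, fun h => hne ?_⟩, by rwa [e.symm_apply_apply]⟩
    obtain ⟨g, -, h₁, h₂⟩ := hα
    rw [← h₁, ← h₂] at h
    exact g.inj h
  have hirred : ∀ β β', (r (e.symm β).1).Iso (r (e.symm β').1) → β = β' := fun β β' h =>
    e.symm.injective (Subtype.ext (hr.irred _ _ h))
  rw [hv.sum_lDatum hk hY hr hmem (fun β => (e.symm β).2) hcomplete hirred,
    embCls_subEmb hF hX, ← sub_eq_zero, ← sub_sub]
  have hL := mk_eq_zero_of_mem_LSet (F := F) ⟨X, Y, hX, hY, a, b, k, hk, n,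
    fun β => r (e.symm β).1, hmem, fun β => (e.symm β).2, hcomplete, hirred, rfl⟩
  rw [map_sub, map_sub, map_sum, apply_ite (Ideal.Quotient.mk _), map_one, map_zero] at hL
  refine Eq.trans (congrArg _ (Finset.sum_congr rfl fun β _ => ?_)) hL
  rw [hv.onePoint hF (hmem β) (Amalg.isOnePointExt_j₂ hk _ (e.symm β).2),
    embCls_subEmb hF (hmem β)]
  rfl

/-! ### The invariant of embeddings with values in `Θ(𝔉)` -/

theorem thetaClass_of_isIso {X Y : Struc σ} (hX : X ∈ F) (hY : Y ∈ F) {f : Emb X Y}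
    (hf : f.IsIso) : thetaClass X Y hX hY f = 1 :=
  Ideal.Quotient.eq.mpr (Ideal.subset_span (Or.inl (Or.inl ⟨X, Y, hX, hY, f, hf, rfl⟩)))

theorem thetaClass_comp {X Y Z : Struc σ} (hX : X ∈ F) (hY : Y ∈ F) (hZ : Z ∈ F)
    (g : Emb Y Z) (f : Emb X Y) :
    thetaClass X Z hX hZ (g.comp f) = thetaClass Y Z hY hZ g * thetaClass X Y hX hY f :=
  Ideal.Quotient.eq.mpr
    (Ideal.subset_span (Or.inl (Or.inr ⟨X, Y, Z, hX, hY, hZ, f, g, rfl⟩)))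

/-- A member of `F` isomorphic to `X`. -/
noncomputable def MemUpIso.rep {X : Struc σ} (h : MemUpIso F X) : Struc σ := h.choose

theorem MemUpIso.rep_mem {X : Struc σ} (h : MemUpIso F X) : h.rep ∈ F := h.choose_spec.1

/-- The chosen isomorphism from `X` to its representative in `F`. -/
noncomputable def MemUpIso.toRep {X : Struc σ} (h : MemUpIso F X) : Emb X h.rep :=
  h.choose_spec.2.choose

theorem MemUpIso.toRep_isIso {X : Struc σ} (h : MemUpIso F X) : h.toRep.IsIso :=
  h.choose_spec.2.choose_spec

/-- The inverse of `MemUpIso.toRep`. -/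
noncomputable def MemUpIso.ofRep {X : Struc σ} (h : MemUpIso F X) : Emb h.rep X :=
  h.toRep_isIso.exists_inv.choose

theorem MemUpIso.ofRep_isIso {X : Struc σ} (h : MemUpIso F X) : h.ofRep.IsIso :=
  h.toRep_isIso.exists_inv.choose_spec.1

theorem MemUpIso.ofRep_toRep {X : Struc σ} (h : MemUpIso F X) (x : X.carrier) :
    h.ofRep.toFun (h.toRep.toFun x) = x :=
  h.toRep_isIso.exists_inv.choose_spec.2.1 x

theorem MemUpIso.toRep_ofRep {X : Struc σ} (h : MemUpIso F X) (x : h.rep.carrier) :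
    h.toRep.toFun (h.ofRep.toFun x) = x :=
  h.toRep_isIso.exists_inv.choose_spec.2.2 x

/-- The embedding of representatives in `F` induced by an embedding. -/
noncomputable def Emb.conj {X Y : Struc σ} (f : Emb X Y) (hX : MemUpIso F X)
    (hY : MemUpIso F Y) : Emb hX.rep hY.rep :=
  hY.toRep.comp (f.comp hX.ofRep)

theorem Emb.conj_comp {X Y Z : Struc σ} (g : Emb Y Z) (f : Emb X Y) (hX : MemUpIso F X)
    (hY : MemUpIso F Y) (hZ : MemUpIso F Z) :
    (g.comp f).conj hX hZ = (g.conj hY hZ).comp (f.conj hX hY) :=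
  Emb.ext_toFun fun x => congrArg (fun y => hZ.toRep.toFun (g.toFun y))
    (hY.ofRep_toRep (f.toFun (hX.ofRep.toFun x))).symm

/-- The class in `Θ(𝔉)` of an embedding between structures isomorphic to members of `F`,
and `0` for other embeddings. -/
noncomputable def thetaCls (F : Set (Struc σ)) ⦃X Y : Struc σ⦄ (f : Emb X Y) : ThetaRing F :=
  if h : MemUpIso F X ∧ MemUpIso F Y then
    thetaClass _ _ h.1.rep_mem h.2.rep_mem (f.conj h.1 h.2) else 0

theorem thetaCls_eq {X Y : Struc σ} (f : Emb X Y) (hX : MemUpIso F X) (hY : MemUpIso F Y) :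
    thetaCls F f = thetaClass _ _ hX.rep_mem hY.rep_mem (f.conj hX hY) :=
  dif_pos ⟨hX, hY⟩

theorem isMult_thetaCls (hF : IsFraisse F) : IsMult F (thetaCls F) where
  iso := fun f hY hf => by
    rw [thetaCls_eq f (MemUpIso.of_iso hf hY) hY]
    exact thetaClass_of_isIso _ _ (hY.toRep_isIso.comp (hf.comp (MemUpIso.ofRep_isIso _)))
  comp := fun g f hZ => by
    have hY := MemUpIso.of_emb hF g hZ
    have hX := MemUpIso.of_emb hF f hY
    rw [thetaCls_eq _ hX hZ, thetaCls_eq _ hX hY, thetaCls_eq _ hY hZ, Emb.conj_comp g f hX hY,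
      thetaClass_comp]

theorem thetaCls_of_mem {X Y : Struc σ} (hX : X ∈ F) (hY : Y ∈ F) (f : Emb X Y) :
    thetaCls F f = thetaClass X Y hX hY f := by
  have hX' := memUpIso_of_mem hX
  have hY' := memUpIso_of_mem hY
  rw [thetaCls_eq f hX' hY', Emb.conj, thetaClass_comp _ hY,
    thetaClass_comp _ hX, thetaClass_of_isIso _ _ hY'.toRep_isIso,
    thetaClass_of_isIso _ _ hX'.ofRep_isIso, one_mul, mul_one]

theorem satAmalg_thetaCls (hF : IsFraisse F) {X Y X' : Struc σ} (i : Emb X Y) (f : Emb X X')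
    (hY : MemUpIso F Y) (hX' : MemUpIso F X') : SatAmalg F (thetaCls F) i f := by
  obtain ⟨m, r, hr⟩ := exists_isSys hF i f
  refine SatAmalg.of_isSys (isMult_thetaCls hF) hr ?_
  have hX := MemUpIso.of_emb hF i hY
  have hconj : ∀ {X Y Z : Struc σ} {g : Emb Y Z} {f : Emb X Y} (hX : MemUpIso F X)
      (hY : MemUpIso F Y) (hZ : MemUpIso F Z) (x : hX.rep.carrier),
      (g.conj hY hZ).toFun ((f.conj hX hY).toFun x) =
        hZ.toRep.toFun (g.toFun (f.toFun (hX.ofRep.toFun x))) :=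
    fun hX hY hZ x => by
      simp only [Emb.conj, Emb.comp, hY.ofRep_toRep]
  let s : Fin m → Amalg (i.conj hX hY) (f.conj hX hX') := fun α =>
    { Z := (hr.mem α).rep
      j₁ := (r α).j₁.conj hY (hr.mem α)
      j₂ := (r α).j₂.conj hX' (hr.mem α)
      comm := fun x => by rw [hconj, hconj, (r α).comm]
      surj := fun z => by
        obtain ⟨w, rfl⟩ := (hr.mem α).toRep_isIso z
        rcases (r α).surj w with ⟨y, rfl⟩ | ⟨y, rfl⟩
        · refine Or.inl ⟨hY.toRep.toFun y, ?_⟩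
          simp only [Emb.conj, Emb.comp, hY.ofRep_toRep]
        · refine Or.inr ⟨hX'.toRep.toFun y, ?_⟩
          simp only [Emb.conj, Emb.comp, hX'.ofRep_toRep] }
  have hs : ∀ α, (s α).Z ∈ F := fun α => (hr.mem α).rep_mem
  have hs_complete : ∀ A : Amalg (i.conj hX hY) (f.conj hX hX'), MemUpIso F A.Z →
      ∃ α, A.Iso (s α) := by
    intro A hA
    let B : Amalg i f :=
      { Z := A.Z
        j₁ := A.j₁.comp hY.toRep
        j₂ := A.j₂.comp hX'.toRep
        comm := fun x => by
          have := A.comm (hX.toRep.toFun x)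
          simpa only [Emb.conj, Emb.comp, hX.ofRep_toRep] using this
        surj := fun z => by
          rcases A.surj z with ⟨y, rfl⟩ | ⟨y, rfl⟩
          · obtain ⟨y, rfl⟩ := hY.toRep_isIso y
            exact Or.inl ⟨y, rfl⟩
          · obtain ⟨y, rfl⟩ := hX'.toRep_isIso y
            exact Or.inr ⟨y, rfl⟩ }
    obtain ⟨α, k, hk, h₁, h₂⟩ := hr.complete B hA
    refine ⟨α, (hr.mem α).toRep.comp k, (hr.mem α).toRep_isIso.comp hk, fun y => ?_, fun y => ?_⟩
    · have := h₁ (hY.ofRep.toFun y)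
      simp only [B, Emb.comp, hY.toRep_ofRep] at this
      exact congrArg _ this
    · have := h₂ (hX'.ofRep.toFun y)
      simp only [B, Emb.comp, hX'.toRep_ofRep] at this
      exact congrArg _ this
  have hs_irred : ∀ α β, (s α).Iso (s β) → α = β := by
    rintro α β ⟨k, hk, h₁, h₂⟩
    refine hr.irred α β ⟨(hr.mem β).ofRep.comp (k.comp (hr.mem α).toRep),
      (hr.mem β).ofRep_isIso.comp (hk.comp (hr.mem α).toRep_isIso), fun y => ?_, fun y => ?_⟩
    · have := congrArg (hr.mem β).ofRep.toFun (h₁ (hY.toRep.toFun y))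
      simpa only [s, Emb.conj, Emb.comp, hY.ofRep_toRep, (hr.mem β).ofRep_toRep] using this
    · have := congrArg (hr.mem β).ofRep.toFun (h₂ (hX'.toRep.toFun y))
      simpa only [s, Emb.conj, Emb.comp, hX'.ofRep_toRep, (hr.mem β).ofRep_toRep] using this
  have hrel : (thetaClass _ _ hX.rep_mem hY.rep_mem (i.conj hX hY) : ThetaRing F) =
      ∑ α, thetaClass _ _ hX'.rep_mem (hs α) (s α).j₂ := by
    simp only [thetaClass]
    rw [← map_sum]
    exact Ideal.Quotient.eq.mpr (Ideal.subset_span (Or.inr ⟨_, _, _, hX.rep_mem, hY.rep_mem,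
      hX'.rep_mem, _, _, m, s, hs, hs_complete, hs_irred, rfl⟩))
  rw [thetaCls_eq i hX hY, hrel]
  exact Finset.sum_congr rfl fun α _ => (thetaCls_eq _ hX' (hr.mem α)).symm

/-! ### The two ring homomorphisms -/

/-- The ring homomorphism `P → Θ(𝔉)` sending `⟦X,a⟧` to `[X,a]`. -/
noncomputable def pringToTheta (hF : IsFraisse F) : PRing F →+* ThetaRing F :=
  (MvPolynomial.aeval (R := ℤ) (Quot.lift
    (fun p : MarkedIn F => thetaCls F (p.1.1.subEmb ({p.2} : Set p.1.1.carrier)ᶜ)) (by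
      rintro ⟨⟨X, hX⟩, a⟩ ⟨⟨Y, hY⟩, b⟩ ⟨g, hg, hgab : g.toFun a = b⟩
      have hv := isMult_thetaCls hF
      have h : IsOnePointExt (g.comp (X.subEmb ({a} : Set X.carrier)ᶜ)) b := by
        rw [IsOnePointExt, show (g.comp (X.subEmb ({a} : Set X.carrier)ᶜ)).toFun =
          g.toFun ∘ (X.subEmb ({a} : Set X.carrier)ᶜ).toFun from rfl, Set.range_comp,
          X.range_subEmb, Set.image_compl_eq ⟨g.inj, hg⟩, Set.image_singleton, hgab]
      exact (one_mul _).symm.trans ((congrArg (· * _) (hv.iso g hY hg).symm).trans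
        ((hv.comp _ _ hY).symm.trans (hv.onePoint hF hY h)))))).toRingHom

theorem pringToTheta_mVar (hF : IsFraisse F) {X : Struc σ} (hX : MemUpIso F X)
    (a : X.carrier) :
    pringToTheta hF (mVar X hX a) = thetaCls F (X.subEmb ({a} : Set X.carrier)ᶜ) :=
  MvPolynomial.aeval_X _ _

theorem pringToTheta_eq_zero (hF : IsFraisse F) {p : PRing F}
    (hp : p ∈ Ideal.span (LSet F) + Ideal.span (QSet F)) : pringToTheta hF p = 0 := by
  have hv := isMult_thetaCls hF
  rw [← RingHom.mem_ker]
  suffices h : Ideal.span (LSet F) ⊔ Ideal.span (QSet F) ≤ RingHom.ker (pringToTheta hF) from h hp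
  refine sup_le (Ideal.span_le.mpr ?_) (Ideal.span_le.mpr ?_)
  · rintro _ ⟨X, Y, hX, hY, a, b, i, hi, m, s, hs, hs_ne, hs_complete, hs_irred, rfl⟩
    obtain ⟨n, r, hr⟩ := exists_isSys hF (X.subEmb ({a} : Set X.carrier)ᶜ)
      ((Y.subEmb ({b} : Set Y.carrier)ᶜ).comp i)
    have h := satAmalg_thetaCls hF _ _ hX hY _ r hr
    rw [hv.sum_lDatum hi hY hr hs hs_ne hs_complete hs_irred] at h
    rw [SetLike.mem_coe, RingHom.mem_ker, map_sub, map_sub, map_sum,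
      apply_ite (pringToTheta hF), map_one, map_zero, pringToTheta_mVar, h, sub_sub, sub_eq_zero]
    congr 1
    refine Finset.sum_congr rfl fun α _ => ?_
    rw [pringToTheta_mVar, hv.onePoint hF (hs α) (Amalg.isOnePointExt_j₂ hi _ (hs_ne α))]
  · rintro _ ⟨X, hX, a, b, hab, ha, hb, -, rfl⟩
    rw [SetLike.mem_coe, RingHom.mem_ker, qElt, map_sub, map_mul, map_mul, sub_eq_zero]
    let b' : (X.restrict ({a} : Set X.carrier)ᶜ).carrier :=
      ⟨b, Set.mem_compl_singleton_iff.mpr hab.symm⟩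
    let a' : (X.restrict ({b} : Set X.carrier)ᶜ).carrier :=
      ⟨a, Set.mem_compl_singleton_iff.mpr hab⟩
    let u := (X.subEmb ({a} : Set X.carrier)ᶜ).comp
      ((X.restrict ({a} : Set X.carrier)ᶜ).subEmb ({b'} : Set _)ᶜ)
    let w := (X.subEmb ({b} : Set X.carrier)ᶜ).comp
      ((X.restrict ({b} : Set X.carrier)ᶜ).subEmb ({a'} : Set _)ᶜ)
    suffices h : thetaCls F u = thetaCls F w from
      (congrArg₂ (· * ·) (pringToTheta_mVar hF hX a) (pringToTheta_mVar hF ha b')).trans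
        ((hv.comp _ _ hX).symm.trans (h.trans ((hv.comp _ _ hX).trans
          (congrArg₂ (· * ·) (pringToTheta_mVar hF hX b) (pringToTheta_mVar hF hb a')).symm)))
    have huw : ∀ x, ∃ y, w.toFun y = u.toFun x := fun x =>
      ⟨⟨⟨x.1.1, fun h => x.2 (Subtype.ext h)⟩, fun h => x.1.2 (congrArg Subtype.val h)⟩, rfl⟩
    have hwu : ∀ y, ∃ x, u.toFun x = w.toFun y := fun y =>
      ⟨⟨⟨y.1.1, fun h => y.2 (Subtype.ext h)⟩, fun h => y.1.2 (congrArg Subtype.val h)⟩, rfl⟩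
    obtain ⟨k, hk⟩ := Emb.exists_lift u w huw
    have hk_iso : k.IsIso := fun y => by
      obtain ⟨x, hx⟩ := hwu y
      exact ⟨x, w.inj ((hk x).trans hx)⟩
    rw [show u = w.comp k from Emb.ext_toFun fun x => (hk x).symm, hv.comp _ _ hX,
      hv.iso k (MemUpIso.of_emb hF w hX) hk_iso, mul_one]

/-- The ring homomorphism from the polynomial ring presenting `Θ(𝔉)` to `P/(𝔟₁+𝔟₂)`. -/
noncomputable def thetaPolyToLQ (F : Set (Struc σ)) : ThetaPoly F →+* LQRing F :=
  (MvPolynomial.aeval (R := ℤ) fun g : ThetaGen F => embCls F g.2.2).toRingHom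

theorem thetaPolyToLQ_thetaVar {X Y : Struc σ} (hX : X ∈ F) (hY : Y ∈ F) (f : Emb X Y) :
    thetaPolyToLQ F (thetaVar X Y hX hY f) = embCls F f :=
  MvPolynomial.aeval_X _ _

theorem thetaPolyToLQ_eq_zero (hF : IsFraisse F) {p : ThetaPoly F}
    (hp : p ∈ Ideal.span (ThetaRels F)) : thetaPolyToLQ F p = 0 := by
  have hv := isMult_embCls hF
  rw [← RingHom.mem_ker]
  refine Ideal.span_le.mpr ?_ hp
  rintro _ ((⟨X, Y, hX, hY, f, hf, rfl⟩ | ⟨X, Y, Z, hX, hY, hZ, f, g, rfl⟩) |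
    ⟨X, Y, X', hX, hY, hX', i, f, m, r, hr, hr_complete, hr_irred, rfl⟩)
  · rw [SetLike.mem_coe, RingHom.mem_ker, map_sub, map_one, thetaPolyToLQ_thetaVar,
      hv.iso f (memUpIso_of_mem hY) hf, sub_self]
  · rw [SetLike.mem_coe, RingHom.mem_ker, map_sub, map_mul, thetaPolyToLQ_thetaVar,
      thetaPolyToLQ_thetaVar, thetaPolyToLQ_thetaVar, hv.comp _ _ (memUpIso_of_mem hZ), sub_self]
  · rw [SetLike.mem_coe, RingHom.mem_ker, map_sub, map_sum, thetaPolyToLQ_thetaVar,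
      satAmalg_embCls hF i f (memUpIso_of_mem hY) (memUpIso_of_mem hX') _ r
        ⟨fun α => memUpIso_of_mem (hr α), hr_complete, hr_irred⟩, sub_eq_zero]
    exact Finset.sum_congr rfl fun α _ => (thetaPolyToLQ_thetaVar _ _ _).symm

/-- The ring homomorphism `P/(𝔟₁+𝔟₂) → Θ(𝔉)`. -/
noncomputable def lqToTheta (hF : IsFraisse F) : LQRing F →+* ThetaRing F :=
  Ideal.Quotient.lift _ (pringToTheta hF) fun _ hp => pringToTheta_eq_zero hF hp

/-- The ring homomorphism `Θ(𝔉) → P/(𝔟₁+𝔟₂)`. -/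
noncomputable def thetaToLQ (hF : IsFraisse F) : ThetaRing F →+* LQRing F :=
  Ideal.Quotient.lift _ (thetaPolyToLQ F) fun _ hp => thetaPolyToLQ_eq_zero hF hp

theorem lqToTheta_markCls (hF : IsFraisse F) {X : Struc σ} (hX : MemUpIso F X)
    (a : X.carrier) :
    lqToTheta hF (markCls hX a) = thetaCls F (X.subEmb ({a} : Set X.carrier)ᶜ) :=
  pringToTheta_mVar hF hX a

theorem thetaToLQ_thetaClass (hF : IsFraisse F) {X Y : Struc σ} (hX : X ∈ F) (hY : Y ∈ F)
    (f : Emb X Y) : thetaToLQ hF (thetaClass X Y hX hY f) = embCls F f :=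
  thetaPolyToLQ_thetaVar hX hY f

theorem thetaToLQ_thetaCls (hF : IsFraisse F) {X Y : Struc σ} (f : Emb X Y)
    (hY : MemUpIso F Y) : thetaToLQ hF (thetaCls F f) = embCls F f := by
  have hv := isMult_embCls hF
  have hX := MemUpIso.of_emb hF f hY
  have hYr := memUpIso_of_mem hY.rep_mem
  rw [thetaCls_eq f hX hY, thetaToLQ_thetaClass, Emb.conj, hv.comp _ _ hYr, hv.comp _ _ hY,
    hv.iso _ hYr hY.toRep_isIso, hv.iso _ hX hX.ofRep_isIso, one_mul, mul_one]

theorem lqToTheta_embCls (hF : IsFraisse F) {X Y : Struc σ} (f : Emb X Y)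
    (hY : MemUpIso F Y) : lqToTheta hF (embCls F f) = thetaCls F f := by
  have hv := isMult_embCls hF
  refine IsMult.eq_of_onePoint (v := fun X Y f => lqToTheta hF (embCls F f)) hF
    ⟨fun f hY hf => ?_, fun g f hZ => ?_⟩ (isMult_thetaCls hF) (fun X a hX => ?_) f hY
  · rw [hv.iso f hY hf, map_one]
  · rw [hv.comp g f hZ, map_mul]
  · rw [embCls_subEmb hF hX, lqToTheta_markCls]

theorem lqToTheta_thetaToLQ (hF : IsFraisse F) :
    (lqToTheta hF).comp (thetaToLQ hF) = RingHom.id _ := by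
  refine Ideal.Quotient.ringHom_ext (MvPolynomial.ringHom_ext' (RingHom.ext_int _ _) ?_)
  rintro ⟨⟨X, hX⟩, ⟨Y, hY⟩, f⟩
  exact (congrArg _ (thetaToLQ_thetaClass hF hX hY f)).trans
    ((lqToTheta_embCls hF f (memUpIso_of_mem hY)).trans (thetaCls_of_mem hX hY f))

theorem thetaToLQ_lqToTheta (hF : IsFraisse F) :
    (thetaToLQ hF).comp (lqToTheta hF) = RingHom.id _ := by
  refine Ideal.Quotient.ringHom_ext (MvPolynomial.ringHom_ext' (RingHom.ext_int _ _) ?_)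
  rintro ⟨⟨X, hX⟩, a⟩
  exact (congrArg _ (lqToTheta_markCls hF hX a)).trans
    ((thetaToLQ_thetaCls hF _ hX).trans (embCls_subEmb hF hX a))

end Paper

namespace Paper

/-- **Proposition 2.8**: for a Fraïssé class `𝔉`, the assignment `⟦X,a⟧ ↦ [X,a]` induces
a ring isomorphism `P/(𝔟₁+𝔟₂) → Θ(𝔉)`.  Here `[X,a] ∈ Θ(𝔉)` is the class of any
one-point extension `W → X` (with `W ∈ 𝔉`) whose image is `X∖{a}`. -/
theorem pring_iso_theta {σ : Signature} {F : Set (Struc σ)} (hF : IsFraisse F) :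
    ∃ e : (PRing F ⧸ (Ideal.span (LSet F) + Ideal.span (QSet F))) ≃+* ThetaRing F,
      ∀ (X : Struc σ) (hXF : X ∈ F) (a : X.carrier)
        (W : Struc σ) (hW : W ∈ F) (g : Emb W X), IsOnePointExt g a →
        e (Ideal.Quotient.mk _ (mVar X (memUpIso_of_mem hXF) a)) =
          thetaClass W X hW hXF g := by
  refine ⟨RingEquiv.ofRingHom (lqToTheta hF) (thetaToLQ hF) (lqToTheta_thetaToLQ hF)
    (thetaToLQ_lqToTheta hF), fun X hXF a W hW g hg => ?_⟩
  rw [← thetaCls_of_mem hW hXF,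
    (isMult_thetaCls hF).onePoint hF (memUpIso_of_mem hXF) hg]
  exact lqToTheta_markCls hF (memUpIso_of_mem hXF) a

end Paper
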